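/- arXiv:0908.2796 — 10 statements merged into one kernel-verified Lean document; each statement's English description precedes it below -/
import Mathlib

section
/- Let F be a field and A ∈ F a nonzero element; set q = A², and for an integer k let {k} = (-A)^k - (-A)^{-k}, with {n}! = {1}{2}···{n} and {0}! = 1. Let λ_i = -q^{i+1} - q^{-i-1} and Q_n(z) = ∏_{i=0}^{n-1}(z - λ_i) ∈ F[z]. Fix m, n ≥ 0 and assume {k} ≠ 0 for all 1 ≤ k ≤ m+n+1. Then in F[z] one has the product formula Q_m · Q_n = ∑_{l=0}^{min(m,n)} C^l_{m,n} Q_{m+n-l}, where C^l_{m,n} = (-1)^l · {m}! {n}! {m+n+1}! / ( {m-l}! {n-l}! {m+n+1-l}! {l}! ). -/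
open Finset Polynomial

/-- Quantum integer `{k} = (-A)^k - (-A)^(-k)`. -/
noncomputable def qint {F : Type*} [Field F] (A : F) (k : ℤ) : F :=
  (-A) ^ k - (-A) ^ (-k)

/-- Quantum factorial `{n}! = {1}{2}⋯{n}`, with `{0}! = 1`. -/
noncomputable def qfact {F : Type*} [Field F] (A : F) (n : ℕ) : F :=
  ∏ k ∈ Finset.range n, qint A ((k : ℤ) + 1)

/-- `λ_i = -q^(i+1) - q^(-i-1)` where `q = A²`. -/
noncomputable def lam {F : Type*} [Field F] (A : F) (i : ℕ) : F :=
  -(A ^ 2) ^ ((i : ℤ) + 1) - (A ^ 2) ^ (-(i : ℤ) - 1)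

/-- `Q_n(z) = ∏_{i=0}^{n-1} (z - λ_i)`. -/
noncomputable def Qpoly {F : Type*} [Field F] (A : F) (n : ℕ) : Polynomial F :=
  ∏ i ∈ Finset.range n, (Polynomial.X - Polynomial.C (lam A i))

/-- `C^l_{m,n} = (-1)^l {m}!{n}!{m+n+1}! / ({m-l}!{n-l}!{m+n+1-l}!{l}!)`. -/
noncomputable def Ccoef {F : Type*} [Field F] (A : F) (l m n : ℕ) : F :=
  (-1) ^ l * (qfact A m * qfact A n * qfact A (m + n + 1)) /
    (qfact A (m - l) * qfact A (n - l) * qfact A (m + n + 1 - l) * qfact A l)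

theorem qint_mul_qint {F : Type*} [Field F] {A : F} (hA : A ≠ 0) (x y l : ℤ) :
    qint A x * qint A y = qint A (x - l) * qint A (y - l) + qint A l * qint A (x + y - l) := by
  have ha : -A ≠ 0 := neg_ne_zero.mpr hA
  have hx := zpow_ne_zero x ha
  have hy := zpow_ne_zero y ha
  have hl := zpow_ne_zero l ha
  simp only [qint, zpow_neg, zpow_sub₀ ha, zpow_add₀ ha]
  generalize (-A) ^ x = u at *
  generalize (-A) ^ y = v at *
  generalize (-A) ^ l = w at *
  field_simp
  ring

theorem lam_sub_lam {F : Type*} [Field F] {A : F} (hA : A ≠ 0) (k n : ℕ) :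
    lam A k - lam A n = -(qint A ((k : ℤ) - n) * qint A ((k : ℤ) + n + 2)) := by
  have ha : -A ≠ 0 := neg_ne_zero.mpr hA
  have hk := zpow_ne_zero (k : ℤ) ha
  have hn := zpow_ne_zero (n : ℤ) ha
  have hsq (j : ℤ) : (A ^ 2) ^ j = (-A) ^ j * (-A) ^ j := by
    rw [← mul_zpow, neg_mul_neg, sq]
  simp only [lam, qint, hsq, zpow_neg, zpow_sub₀ ha, zpow_add₀ ha, zpow_ofNat]
  generalize (-A) ^ (k : ℤ) = u at *
  generalize (-A) ^ (n : ℤ) = v at *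
  field_simp
  ring

/-- The quantum falling factorial `{x}{x-1}⋯{x-l+1}`. -/
noncomputable def qdescFact {F : Type*} [Field F] (A : F) (x : ℤ) (l : ℕ) : F :=
  ∏ i ∈ Finset.range l, qint A (x - i)

theorem qdescFact_succ {F : Type*} [Field F] (A : F) (x : ℤ) (l : ℕ) :
    qdescFact A x (l + 1) = qdescFact A x l * qint A (x - l) :=
  Finset.prod_range_succ _ _

theorem qdescFact_add_one_succ {F : Type*} [Field F] (A : F) (x : ℤ) (l : ℕ) :
    qdescFact A (x + 1) (l + 1) = qint A (x + 1) * qdescFact A x l := by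
  simp [qdescFact, Finset.prod_range_succ', mul_comm]

theorem qdescFact_eq_zero {F : Type*} [Field F] (A : F) {n l : ℕ} (h : n < l) :
    qdescFact A n l = 0 :=
  Finset.prod_eq_zero (Finset.mem_range.mpr h) (by simp [qint])

theorem qfact_succ {F : Type*} [Field F] (A : F) (n : ℕ) :
    qfact A (n + 1) = qfact A n * qint A ((n : ℤ) + 1) :=
  Finset.prod_range_succ _ _

theorem qdescFact_mul_qfact {F : Type*} [Field F] (A : F) {n l : ℕ} (h : l ≤ n) :
    qdescFact A n l * qfact A (n - l) = qfact A n := by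
  induction l with
  | zero => simp [qdescFact]
  | succ l ih =>
    rw [← ih (by lia), show n - l = n - (l + 1) + 1 by lia, qfact_succ, qdescFact_succ,
      show ((n - (l + 1) : ℕ) : ℤ) + 1 = n - l by lia]
    ring

theorem qfact_ne_zero {F : Type*} [Field F] {A : F} {n : ℕ}
    (h : ∀ k : ℕ, 1 ≤ k → k ≤ n → qint A (k : ℤ) ≠ 0) : qfact A n ≠ 0 :=
  Finset.prod_ne_zero_iff.mpr fun k hk => by
    exact_mod_cast h (k + 1) (by lia) (Finset.mem_range.mp hk)

/-- The structure coefficient `Ccoef` with quotients of factorials replaced by falling factorials,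
so that it vanishes when `l > n`. -/
noncomputable def descCoef {F : Type*} [Field F] (A : F) (l m n : ℕ) : F :=
  (-1) ^ l * (qdescFact A m l * qdescFact A n l * qdescFact A ((m : ℤ) + n + 1) l) / qfact A l

theorem descCoef_zero {F : Type*} [Field F] (A : F) (m n : ℕ) : descCoef A 0 m n = 1 := by
  simp [descCoef, qdescFact, qfact]

theorem descCoef_eq_zero {F : Type*} [Field F] (A : F) {l m n : ℕ} (h : n < l) :
    descCoef A l m n = 0 := by
  simp [descCoef, qdescFact_eq_zero A h]

theorem descCoef_eq_Ccoef {F : Type*} [Field F] {A : F} {l m n : ℕ}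
    (hk : ∀ k : ℕ, 1 ≤ k → k ≤ m + n + 1 → qint A (k : ℤ) ≠ 0) (hm : l ≤ m) (hn : l ≤ n) :
    descCoef A l m n = Ccoef A l m n := by
  have hne (j : ℕ) (hj : j ≤ m + n + 1) : qfact A j ≠ 0 :=
    qfact_ne_zero fun k h1 h2 => hk k h1 (h2.trans hj)
  have h1 := hne (m - l) (by lia)
  have h2 := hne (n - l) (by lia)
  have h3 := hne (m + n + 1 - l) (by lia)
  have h4 := hne l (by lia)
  rw [descCoef, Ccoef, ← qdescFact_mul_qfact A hm, ← qdescFact_mul_qfact A hn,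
    ← qdescFact_mul_qfact A (show l ≤ m + n + 1 by lia)]
  push_cast
  field_simp

theorem descCoef_succ_succ {F : Type*} [Field F] {A : F} (hA : A ≠ 0) {l m : ℕ} (n : ℕ)
    (hk : ∀ k : ℕ, 1 ≤ k → k ≤ m → qint A (k : ℤ) ≠ 0) (hl : l < m) :
    descCoef A (l + 1) m (n + 1) =
      descCoef A (l + 1) m n + descCoef A l m n * (lam A (m + n - l) - lam A n) := by
  have h1 : qint A ((l : ℤ) + 1) ≠ 0 := by exact_mod_cast hk (l + 1) (by lia) hl
  have h2 : qfact A l ≠ 0 := qfact_ne_zero fun k h1 h2 => hk k h1 (by lia)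
  have key := qint_mul_qint hA ((n : ℤ) + 1) ((m : ℤ) + n + 1 + 1) (l + 1)
  rw [show (n : ℤ) + 1 - (l + 1) = n - l by ring,
    show (m : ℤ) + n + 1 + 1 - (l + 1) = m + n + 1 - l by ring] at key
  rw [lam_sub_lam hA, show ((m + n - l : ℕ) : ℤ) - n = m - l by lia,
    show ((m + n - l : ℕ) : ℤ) + n + 2 = (n : ℤ) + 1 + (m + n + 1 + 1) - (l + 1) by lia]
  simp only [descCoef]
  rw [show (m : ℤ) + (n + 1 : ℕ) + 1 = m + n + 1 + 1 by push_cast; ring, Nat.cast_succ n,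
    qdescFact_add_one_succ, qdescFact_add_one_succ, qdescFact_succ, qdescFact_succ,
    qdescFact_succ, qfact_succ]
  field_simp
  linear_combination (-1) ^ (l + 1) * qdescFact A m l * qint A (m - l) * qdescFact A n l *
    qdescFact A (m + n + 1) l * key

theorem Qpoly_mul_X_sub_C {F : Type*} [Field F] (A : F) (k n : ℕ) :
    Qpoly A k * (X - C (lam A n)) = Qpoly A (k + 1) + C (lam A k - lam A n) * Qpoly A k := by
  rw [Qpoly, Qpoly, Finset.prod_range_succ, C_sub]
  ring

theorem Qpoly_mul_Qpoly {F : Type*} [Field F] {A : F} (hA : A ≠ 0) {m : ℕ} (n : ℕ)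
    (hk : ∀ k : ℕ, 1 ≤ k → k ≤ m → qint A (k : ℤ) ≠ 0) :
    Qpoly A m * Qpoly A n =
      ∑ l ∈ Finset.range (m + 1), C (descCoef A l m n) * Qpoly A (m + n - l) := by
  induction n with
  | zero =>
    rw [Finset.sum_range_succ', Finset.sum_eq_zero fun l _ => by
      rw [descCoef_eq_zero A l.succ_pos, C_0, zero_mul]]
    simp [descCoef_zero, Qpoly]
  | succ n ih =>
    have hQ : Qpoly A (n + 1) = Qpoly A n * (X - C (lam A n)) := Finset.prod_range_succ _ _
    rw [hQ, ← mul_assoc, ih, Finset.sum_mul]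
    simp only [mul_assoc, Qpoly_mul_X_sub_C, mul_add, Finset.sum_add_distrib]
    rw [Finset.sum_range_succ', Finset.sum_range_succ (fun l => C (descCoef A l m n) * (_ * _)),
      Finset.sum_range_succ' (fun l => C (descCoef A l m (n + 1)) * _), descCoef_zero,
      descCoef_zero, Nat.add_sub_cancel_left m n, sub_self, C_0, zero_mul, mul_zero, add_zero,
      add_right_comm, ← Finset.sum_add_distrib]
    congr 1
    refine Finset.sum_congr rfl fun l hl => ?_
    have hl := Finset.mem_range.mp hl
    rw [descCoef_succ_succ hA n hk hl, show m + n - (l + 1) + 1 = m + n - l by lia,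
      show m + (n + 1) - (l + 1) = m + n - l by lia, C_add, C_mul]
    ring

/-- Proposition 4.7 (case c = 0): the product formula
`Q_m · Q_n = ∑_{l=0}^{min(m,n)} C^l_{m,n} Q_{m+n-l}` in `F[z]`. -/
theorem stmt0 {F : Type*} [Field F] (A : F) (hA : A ≠ 0) (m n : ℕ)
    (hk : ∀ k : ℕ, 1 ≤ k → k ≤ m + n + 1 → qint A (k : ℤ) ≠ 0) :
    Qpoly A m * Qpoly A n =
      ∑ l ∈ Finset.range (min m n + 1),
        Polynomial.C (Ccoef A l m n) * Qpoly A (m + n - l) := by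
  rw [Qpoly_mul_Qpoly hA n fun k h1 h2 => hk k h1 (by lia)]
  symm
  refine Finset.sum_subset_zero_on_sdiff (Finset.range_mono (by lia)) (fun l hl => ?_)
    fun l hl => ?_
  · simp only [Finset.mem_sdiff, Finset.mem_range] at hl
    rw [descCoef_eq_zero A (by lia), C_0, zero_mul]
  · have hl := Finset.mem_range.mp hl
    rw [descCoef_eq_Ccoef hk (by lia) (by lia)]
end

section
/- Let p ≥ 5 be prime, d = (p-1)/2, ζ a primitive p-th root of unity, O = ℤ[ζ], h = 1-ζ, A = -ζ^{d+1}, and {k} = (-A)^k - (-A)^{-k}, {n}! = {1}···{n}. For m, n, l with 0 ≤ l ≤ min(m,n) and m+n+1 ≤ p-1, the element C^l_{m,n} = (-1)^l {m}!{n}!{m+n+1}! / ({m-l}!{n-l}!{m+n+1-l}!{l}!) of ℚ(ζ) lies in O and is associated in O to h^{2l}, i.e., C^l_{m,n} = u·(1-ζ)^{2l} for some unit u of O. -/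
open Finset

/-- The ring of cyclotomic integers `O = ℤ[ζ]`, as a subring of `ℂ`. -/
noncomputable def Oring (ζ : ℂ) : Subring ℂ := Subring.closure {ζ}

/-- The inverse of a unit of a subring of a field is its inverse in the field. -/
theorem coe_inv_unit {F : Type*} [Field F] {R : Subring F} (u : Rˣ) :
    (((u⁻¹ : Rˣ) : R) : F) = ((u : R) : F)⁻¹ :=
  eq_inv_of_mul_eq_one_left (congrArg Subtype.val u.inv_mul)

theorem coe_unit_ne_zero {F : Type*} [Field F] {R : Subring F} (u : Rˣ) : ((u : R) : F) ≠ 0 :=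
  left_ne_zero_of_mul_eq_one (congrArg Subtype.val u.mul_inv)

/-- A quantum integer `{k}` with `(-A)² = ζ` and `k` prime to the order of `ζ` is a unit of `ℤ[ζ]`
times `1 - ζ`. -/
theorem exists_unit_qint_eq {p : ℕ} {ζ A : ℂ} (hζ : IsPrimitiveRoot ζ p) (hp : 2 ≤ p) {r : ℕ}
    (hA : -A = ζ ^ r) (hA2 : (-A) ^ 2 = ζ) {k : ℕ} (hk : k.Coprime p) :
    ∃ u : (Oring ζ)ˣ, qint A k = ((u : Oring ζ) : ℂ) * (1 - ζ) := by
  have hmem : ζ ∈ Oring ζ := Subring.subset_closure rfl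
  let z : Oring ζ := ⟨ζ, hmem⟩
  have hz : IsPrimitiveRoot z p :=
    IsPrimitiveRoot.of_map_of_injective (f := (Oring ζ).subtype) hζ Subtype.val_injective
  obtain ⟨v, hv⟩ := hz.associated_sub_one_pow_sub_one_of_coprime hk
  obtain ⟨w, hw⟩ := ((hz.isUnit (by omega)).pow r).pow k
  have hv' : (ζ - 1) * ((v : Oring ζ) : ℂ) = ζ ^ k - 1 := congrArg Subtype.val hv
  have hw' : ((w : Oring ζ) : ℂ) = (-A) ^ k := by
    rw [hA]
    exact congrArg Subtype.val hw
  have hwi : ((w : Oring ζ) : ℂ) * (((w⁻¹ : (Oring ζ)ˣ) : Oring ζ) : ℂ) = 1 :=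
    congrArg Subtype.val w.mul_inv
  refine ⟨-(w⁻¹ * v), ?_⟩
  have hsq : (-A) ^ k * (-A) ^ k = ζ ^ k := by rw [← mul_pow, ← sq, hA2]
  rw [qint, zpow_neg, zpow_natCast, ← hw', ← eq_inv_of_mul_eq_one_right hwi]
  rw [← hw'] at hsq
  push_cast
  linear_combination (-((w : Oring ζ) : ℂ)) * hwi
    + (((w⁻¹ : (Oring ζ)ˣ) : Oring ζ) : ℂ) * (hsq - hv')

/-- For `n < p`, the quantum factorial `{n}!` is a unit of `ℤ[ζ]` times `(1 - ζ) ^ n`. -/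
theorem exists_unit_qfact_eq {p : ℕ} (hp : p.Prime) {ζ A : ℂ} (hζ : IsPrimitiveRoot ζ p) {r : ℕ}
    (hA : -A = ζ ^ r) (hA2 : (-A) ^ 2 = ζ) {n : ℕ} (hn : n < p) :
    ∃ u : (Oring ζ)ˣ, qfact A n = ((u : Oring ζ) : ℂ) * (1 - ζ) ^ n := by
  induction n with
  | zero => exact ⟨1, by simp [qfact]⟩
  | succ n ih =>
    obtain ⟨u, hu⟩ := ih (by omega)
    obtain ⟨v, hv⟩ := exists_unit_qint_eq hζ hp.two_le hA hA2
      (Nat.coprime_of_lt_prime n.succ_ne_zero hn hp).symm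
    refine ⟨u * v, ?_⟩
    rw [qfact] at hu
    rw [Nat.cast_succ] at hv
    rw [qfact, prod_range_succ, hu, hv]
    push_cast
    ring

/-- If each quantum factorial `{j}!` is a unit times `h ^ j`, then `C^l_{m,n}` is a unit times
`h ^ (2 * l)`. -/
theorem exists_unit_Ccoef_eq {F : Type*} [Field F] {R : Subring F} {A h : F} (hh : h ≠ 0)
    {l m n : ℕ} (hlm : l ≤ m) (hln : l ≤ n)
    (hfact : ∀ j ≤ m + n + 1, ∃ u : Rˣ, qfact A j = ((u : R) : F) * h ^ j) :
    ∃ u : Rˣ, Ccoef A l m n = ((u : R) : F) * h ^ (2 * l) := by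
  obtain ⟨a, ha⟩ := hfact m (by omega)
  obtain ⟨b, hb⟩ := hfact n (by omega)
  obtain ⟨c, hc⟩ := hfact (m + n + 1) le_rfl
  obtain ⟨e, he⟩ := hfact (m - l) (by omega)
  obtain ⟨f, hf⟩ := hfact (n - l) (by omega)
  obtain ⟨g, hg⟩ := hfact (m + n + 1 - l) (by omega)
  obtain ⟨i, hi⟩ := hfact l (by omega)
  have hpow : h ^ m * h ^ n * h ^ (m + n + 1) =
      h ^ (2 * l) * (h ^ (m - l) * h ^ (n - l) * h ^ (m + n + 1 - l) * h ^ l) := by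
    simp only [← pow_add]
    congr 1
    omega
  have he0 := coe_unit_ne_zero e
  have hf0 := coe_unit_ne_zero f
  have hg0 := coe_unit_ne_zero g
  have hi0 := coe_unit_ne_zero i
  refine ⟨(-1) ^ l * (a * b * c) * (e * f * g * i)⁻¹, ?_⟩
  rw [Ccoef, ha, hb, hc, he, hf, hg, hi, Units.val_mul, Subring.coe_mul, coe_inv_unit]
  push_cast
  rw [← div_eq_mul_inv, div_mul_eq_mul_div, div_eq_div_iff (by simp [*]) (by simp [*])]
  linear_combination (-1) ^ l * ((a : R) : F) * ((b : R) : F) * ((c : R) : F) *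
    (((e : R) : F) * ((f : R) : F) * ((g : R) : F) * ((i : R) : F)) * hpow

/-- Proposition 4.7, valuation statement: with `p ≥ 5` prime, `d = (p-1)/2`,
`ζ` a primitive `p`-th root of unity, `A = -ζ^(d+1)`, `h = 1-ζ`, and
`0 ≤ l ≤ min(m,n)`, `m+n+1 ≤ p-1`, the element `C^l_{m,n}` lies in `O = ℤ[ζ]`
and equals a unit of `O` times `h^(2l)`. -/
theorem stmt3 (p : ℕ) (hp : p.Prime) (hp5 : 5 ≤ p) (ζ : ℂ)
    (hζ : IsPrimitiveRoot ζ p) (A : ℂ) (hA : A = -ζ ^ ((p - 1) / 2 + 1))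
    (l m n : ℕ) (hl : l ≤ min m n) (hmn : m + n + 1 ≤ p - 1) :
    Ccoef A l m n ∈ Oring ζ ∧
    ∃ u : (Oring ζ)ˣ,
      Ccoef A l m n = ((u : Oring ζ) : ℂ) * (1 - ζ) ^ (2 * l) := by
  have hB : -A = ζ ^ ((p - 1) / 2 + 1) := by rw [hA, neg_neg]
  have hB2 : (-A) ^ 2 = ζ := by
    obtain ⟨k, rfl⟩ := hp.odd_of_ne_two (by omega)
    rw [hB, ← pow_mul, show ((2 * k + 1 - 1) / 2 + 1) * 2 = 2 * k + 1 + 1 by omega, pow_succ,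
      hζ.pow_eq_one, one_mul]
  obtain ⟨hlm, hln⟩ := le_min_iff.mp hl
  have hh : 1 - ζ ≠ 0 := sub_ne_zero.mpr (hζ.ne_one hp.one_lt).symm
  obtain ⟨u, hu⟩ := exists_unit_Ccoef_eq hh hlm hln
    fun j hj => exists_unit_qfact_eq hp hζ hB hB2 (show j < p by omega)
  refine ⟨?_, u, hu⟩
  rw [hu]
  have hmem : ζ ∈ Oring ζ := Subring.subset_closure rfl
  exact (Oring ζ).mul_mem (u : Oring ζ).2
    ((Oring ζ).pow_mem ((Oring ζ).sub_mem (Oring ζ).one_mem hmem) _)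
end

section
/- Let p ≥ 5 be prime, d = (p-1)/2, ζ a primitive p-th root of unity, q = ζ, O = ℤ[ζ], h = 1-ζ, A = -q^{d+1}. For integers c, n with 0 ≤ c ≤ d-1 and 0 ≤ n ≤ d-c-1, the element q^{-c(c+1)/2} · ( {2c+2n+1}!! · {2c+n+1}⁺! / {n}! ) · ( ({c}_q!)² / ({1}_q · {2c}_q!) ) of ℚ(ζ) lies in O and is associated in O to h^c, i.e., equals (1-ζ)^c times a unit of O. -/
open Finset

/-- `{k}⁺ = (-A)^k + (-A)^(-k)`. -/
noncomputable def qintp {F : Type*} [Field F] (A : F) (k : ℤ) : F :=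
  (-A) ^ k + (-A) ^ (-k)

/-- `{k}_q = q^k - q^(-k)`. -/
noncomputable def qqint {F : Type*} [Field F] (q : F) (k : ℤ) : F :=
  q ^ k - q ^ (-k)

/-- `{n}⁺! = {1}⁺{2}⁺⋯{n}⁺`. -/
noncomputable def qpfact {F : Type*} [Field F] (A : F) (n : ℕ) : F :=
  ∏ k ∈ Finset.range n, qintp A ((k : ℤ) + 1)

/-- `{n}_q! = {1}_q{2}_q⋯{n}_q`. -/
noncomputable def qqfact {F : Type*} [Field F] (q : F) (n : ℕ) : F :=
  ∏ k ∈ Finset.range n, qqint q ((k : ℤ) + 1)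

/-- Quantum double factorial `{n}!! = {n}{n-2}⋯`, ending in `{1}` or `{2}`. -/
noncomputable def qdfact {F : Type*} [Field F] (A : F) : ℕ → F
  | 0 => 1
  | 1 => qint A 1
  | (n + 2) => qint A ((n : ℤ) + 2) * qdfact A n

/-- `x` is a unit of the subring `R` times `h ^ m`. -/
def IsUnitMulZPow {F : Type*} [Field F] (R : Subring F) (h : F) (m : ℤ) (x : F) : Prop :=
  ∃ u : Rˣ, x = ((u : R) : F) * h ^ m

namespace IsUnitMulZPow

variable {F : Type*} [Field F] {R : Subring F} {h x y : F} {m k : ℤ}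

theorem of_isUnit {r : R} (hr : IsUnit r) : IsUnitMulZPow R h 0 (r : F) := by
  obtain ⟨u, rfl⟩ := hr
  exact ⟨u, by simp⟩

theorem one : IsUnitMulZPow R h 0 (1 : F) := ⟨1, by simp⟩

theorem mul (hh : h ≠ 0) (hx : IsUnitMulZPow R h m x) (hy : IsUnitMulZPow R h k y) :
    IsUnitMulZPow R h (m + k) (x * y) := by
  obtain ⟨u, rfl⟩ := hx
  obtain ⟨v, rfl⟩ := hy
  refine ⟨u * v, ?_⟩
  rw [zpow_add₀ hh]
  push_cast
  ring

theorem inv (hx : IsUnitMulZPow R h m x) : IsUnitMulZPow R h (-m) x⁻¹ := by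
  obtain ⟨u, rfl⟩ := hx
  refine ⟨u⁻¹, ?_⟩
  have huv : (((u⁻¹ : Rˣ) : R) : F) * ((u : R) : F) = 1 := by
    exact_mod_cast congrArg (Subtype.val) (u.inv_mul)
  rw [mul_inv, zpow_neg, eq_inv_of_mul_eq_one_left huv]

theorem div (hh : h ≠ 0) (hx : IsUnitMulZPow R h m x) (hy : IsUnitMulZPow R h k y) :
    IsUnitMulZPow R h (m - k) (x / y) := by
  rw [div_eq_mul_inv, sub_eq_add_neg]
  exact hx.mul hh hy.inv

theorem zpow (hx : IsUnitMulZPow R h 0 x) (j : ℤ) : IsUnitMulZPow R h 0 (x ^ j) := by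
  obtain ⟨u, rfl⟩ := hx
  refine ⟨u ^ j, ?_⟩
  have := congrArg Units.val (map_zpow (Units.map (R.subtype : R →* F)) u j)
  rw [Units.val_zpow_eq_zpow_val] at this
  rw [zpow_zero, mul_one, mul_one]
  exact this.symm

theorem prod_range (hh : h ≠ 0) {f : ℕ → F} {n : ℕ}
    (hf : ∀ i < n, IsUnitMulZPow R h m (f i)) :
    IsUnitMulZPow R h (n * m) (∏ i ∈ Finset.range n, f i) := by
  induction n with
  | zero => simpa using one
  | succ n ih =>
    rw [Finset.prod_range_succ]
    have := (ih fun i hi => hf i (by omega)).mul hh (hf n (by omega))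
    convert this using 1
    push_cast
    ring

end IsUnitMulZPow

namespace IsPrimitiveRoot

variable {p : ℕ} {ζ : ℂ}

theorem exists_coe_Oring (hζ : IsPrimitiveRoot ζ p) :
    ∃ z : Oring ζ, (z : ℂ) = ζ ∧ IsPrimitiveRoot z p :=
  ⟨⟨ζ, Subring.subset_closure rfl⟩, rfl, IsPrimitiveRoot.coe_submonoidClass_iff.mp hζ⟩

theorem isUnitMulZPow_self (hζ : IsPrimitiveRoot ζ p) (hp : p.Prime) :
    IsUnitMulZPow (Oring ζ) (1 - ζ) 0 ζ := by
  obtain ⟨z, hz, hzp⟩ := hζ.exists_coe_Oring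
  have := IsUnitMulZPow.of_isUnit (h := 1 - ζ) (hzp.isUnit hp.ne_zero)
  rwa [hz] at this

theorem isUnitMulZPow_pow_sub_one (hζ : IsPrimitiveRoot ζ p) {k : ℕ} (hk : k.Coprime p) :
    IsUnitMulZPow (Oring ζ) (1 - ζ) 1 (ζ ^ k - 1) := by
  obtain ⟨z, hz, hzp⟩ := hζ.exists_coe_Oring
  obtain ⟨u, hu⟩ := hzp.associated_sub_one_pow_sub_one_of_coprime hk
  refine ⟨-u, ?_⟩
  have := congrArg (Subtype.val) hu
  push_cast [hz] at this
  rw [← this, Units.val_neg, zpow_one]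
  push_cast
  ring

theorem isUnitMulZPow_pow_add_one (hζ : IsPrimitiveRoot ζ p) {k : ℕ} (hk : k.Coprime p)
    (hp : p.Prime) (hp2 : Nat.Coprime 2 p) :
    IsUnitMulZPow (Oring ζ) (1 - ζ) 0 (ζ ^ k + 1) := by
  obtain ⟨z, hz, hzp⟩ := hζ.exists_coe_Oring
  have := IsUnitMulZPow.of_isUnit (h := 1 - ζ)
    ((hzp.pow_of_coprime k hk).geom_sum_isUnit hp.two_le hp2)
  simpa [Finset.sum_range_succ, hz, add_comm] using this

theorem isUnitMulZPow_qqint (hζ : IsPrimitiveRoot ζ p) (hp : p.Prime)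
    (hp2 : Nat.Coprime 2 p) {k : ℕ} (hk : k.Coprime p) :
    IsUnitMulZPow (Oring ζ) (1 - ζ) 1 (qqint ζ k) := by
  have hζ0 := hζ.ne_zero hp.ne_zero
  have hh : 1 - ζ ≠ 0 := sub_ne_zero.mpr (hζ.ne_one hp.one_lt).symm
  have := ((hζ.isUnitMulZPow_self hp).zpow (-k)).mul hh
    (hζ.isUnitMulZPow_pow_sub_one (Nat.Coprime.mul_left hp2 hk))
  rw [zero_add] at this
  convert this using 1
  rw [qqint, zpow_neg, zpow_natCast]
  field_simp
  ring

theorem isUnitMulZPow_qint (hζ : IsPrimitiveRoot ζ p) (hp : p.Prime) {A : ℂ}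
    (hA : IsUnitMulZPow (Oring ζ) (1 - ζ) 0 (-A)) (hA2 : (-A) ^ 2 = ζ)
    {k : ℕ} (hk : k.Coprime p) :
    IsUnitMulZPow (Oring ζ) (1 - ζ) 1 (qint A k) := by
  have hζ0 := hζ.ne_zero hp.ne_zero
  have hA0 : -A ≠ 0 := by
    rintro h
    simp [← hA2, h] at hζ0
  have hh : 1 - ζ ≠ 0 := sub_ne_zero.mpr (hζ.ne_one hp.one_lt).symm
  have := (hA.zpow (-k)).mul hh (hζ.isUnitMulZPow_pow_sub_one hk)
  rw [zero_add] at this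
  convert this using 1
  rw [qint, zpow_neg, zpow_natCast, ← hA2]
  generalize -A = a at *
  field_simp
  ring

theorem isUnitMulZPow_qintp (hζ : IsPrimitiveRoot ζ p) (hp : p.Prime)
    (hp2 : Nat.Coprime 2 p) {A : ℂ}
    (hA : IsUnitMulZPow (Oring ζ) (1 - ζ) 0 (-A)) (hA2 : (-A) ^ 2 = ζ)
    {k : ℕ} (hk : k.Coprime p) :
    IsUnitMulZPow (Oring ζ) (1 - ζ) 0 (qintp A k) := by
  have hζ0 := hζ.ne_zero hp.ne_zero
  have hA0 : -A ≠ 0 := by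
    rintro h
    simp [← hA2, h] at hζ0
  have hh : 1 - ζ ≠ 0 := sub_ne_zero.mpr (hζ.ne_one hp.one_lt).symm
  have := (hA.zpow (-k)).mul hh (hζ.isUnitMulZPow_pow_add_one hk hp hp2)
  rw [zero_add] at this
  convert this using 1
  rw [qintp, zpow_neg, zpow_natCast, ← hA2]
  generalize -A = a at *
  field_simp
  ring

end IsPrimitiveRoot

theorem qdfact_odd {F : Type*} [Field F] (A : F) (m : ℕ) :
    qdfact A (2 * m + 1) = ∏ i ∈ Finset.range (m + 1), qint A ((2 * i + 1 : ℕ) : ℤ) := by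
  induction m with
  | zero => simp [qdfact]
  | succ m ih =>
    rw [Finset.prod_range_succ, ← ih, mul_comm (qdfact A _), show 2 * (m + 1) + 1 = (2 * m + 1) + 2 by ring,
      qdfact]
    push_cast
    rfl

/-- Corollary to Theorem 2.2: the Hopf pairing norm
`((Q'ₙ^{(c)}, Q'ₙ^{(c)})) = q^{-c(c+1)/2}·({2c+2n+1}!!·{2c+n+1}⁺!/{n}!)·(({c}_q!)²/({1}_q·{2c}_q!))`
lies in `O = ℤ[ζ]` and equals a unit of `O` times `h^c`, where `h = 1-ζ`. -/
theorem stmt6 (p : ℕ) (hp : p.Prime) (hp5 : 5 ≤ p) (ζ : ℂ)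
    (hζ : IsPrimitiveRoot ζ p) (A : ℂ) (hA : A = -ζ ^ ((p - 1) / 2 + 1))
    (c n : ℕ) (hc : c ≤ (p - 1) / 2 - 1) (hn : n ≤ (p - 1) / 2 - c - 1) :
    ζ ^ (-((c * (c + 1) / 2 : ℕ) : ℤ)) *
        (qdfact A (2 * c + 2 * n + 1) * qpfact A (2 * c + n + 1) / qfact A n) *
        ((qqfact ζ c) ^ 2 / (qqint ζ 1 * qqfact ζ (2 * c))) ∈ Oring ζ ∧
    ∃ u : (Oring ζ)ˣ,
      ζ ^ (-((c * (c + 1) / 2 : ℕ) : ℤ)) *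
          (qdfact A (2 * c + 2 * n + 1) * qpfact A (2 * c + n + 1) / qfact A n) *
          ((qqfact ζ c) ^ 2 / (qqint ζ 1 * qqfact ζ (2 * c))) =
        ((u : Oring ζ) : ℂ) * (1 - ζ) ^ c := by
  obtain ⟨d, rfl⟩ : ∃ d, p = 2 * d + 1 := hp.odd_of_ne_two (by omega)
  have hd : (2 * d + 1 - 1) / 2 = d := by omega
  rw [hd] at hA hc hn
  have hh : 1 - ζ ≠ 0 := sub_ne_zero.mpr (hζ.ne_one hp.one_lt).symm
  have hcop : ∀ k : ℕ, 0 < k → k < 2 * d + 1 → k.Coprime (2 * d + 1) := fun k h0 hk =>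
    (Nat.coprime_of_lt_prime h0.ne' hk hp).symm
  have hp2 : Nat.Coprime 2 (2 * d + 1) := hcop 2 (by omega) (by omega)
  have hA1 : -A = ζ ^ (d + 1) := by rw [hA, neg_neg]
  have hA2 : (-A) ^ 2 = ζ := by
    rw [hA1, ← pow_mul, show (d + 1) * 2 = (2 * d + 1) + 1 by ring, pow_succ, hζ.pow_eq_one,
      one_mul]
  have hself := hζ.isUnitMulZPow_self hp
  have hAu : IsUnitMulZPow (Oring ζ) (1 - ζ) 0 (-A) := by
    rw [hA1, ← zpow_natCast]
    exact hself.zpow _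
  have hdf : IsUnitMulZPow (Oring ζ) (1 - ζ) ((c + n + 1 : ℕ) * 1)
      (qdfact A (2 * c + 2 * n + 1)) := by
    rw [← mul_add, qdfact_odd]
    exact .prod_range hh fun i hi =>
      hζ.isUnitMulZPow_qint hp hAu hA2 (hcop _ (by omega) (by omega))
  have hpf : IsUnitMulZPow (Oring ζ) (1 - ζ) ((2 * c + n + 1 : ℕ) * 0)
      (qpfact A (2 * c + n + 1)) :=
    .prod_range hh fun i hi => by
      exact_mod_cast hζ.isUnitMulZPow_qintp hp hp2 hAu hA2 (hcop (i + 1) (by omega) (by omega))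
  have hf : IsUnitMulZPow (Oring ζ) (1 - ζ) (n * 1) (qfact A n) :=
    .prod_range hh fun i hi => by
      exact_mod_cast hζ.isUnitMulZPow_qint hp hAu hA2 (hcop (i + 1) (by omega) (by omega))
  have hqf : ∀ m < 2 * d + 1, IsUnitMulZPow (Oring ζ) (1 - ζ) (m * 1) (qqfact ζ m) :=
    fun m hm => .prod_range hh fun i hi => by
      exact_mod_cast hζ.isUnitMulZPow_qqint hp hp2 (hcop (i + 1) (by omega) (by omega))
  have hq1 : IsUnitMulZPow (Oring ζ) (1 - ζ) 1 (qqint ζ 1) := by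
    exact_mod_cast hζ.isUnitMulZPow_qqint hp hp2 (hcop 1 (by omega) (by omega))
  have hqc := hqf c (by omega)
  obtain ⟨u, hu⟩ := ((hself.zpow (-((c * (c + 1) / 2 : ℕ) : ℤ))).mul hh
    ((hdf.mul hh hpf).div hh hf)).mul hh
    ((hqc.mul hh hqc).div hh (hq1.mul hh (hqf (2 * c) (by omega))))
  have hexp : (0 + (((c + n + 1 : ℕ) : ℤ) * 1 + ((2 * c + n + 1 : ℕ) : ℤ) * 0 - n * 1) +
      ((c : ℤ) * 1 + c * 1 - (1 + ((2 * c : ℕ) : ℤ) * 1))) = (c : ℤ) := by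
    push_cast
    ring
  rw [hexp, zpow_natCast, ← sq] at hu
  refine ⟨?_, u, hu⟩
  rw [hu]
  have hmem : ζ ∈ Oring ζ := Subring.subset_closure rfl
  exact mul_mem (u : Oring ζ).2 (pow_mem (sub_mem (one_mem _) hmem) c)
end

section
/- Let p ≥ 5 be prime, d = (p-1)/2, ζ a primitive p-th root of unity, O = ℤ[ζ], A = -ζ^{d+1}. For integers c, m, n with 0 ≤ c ≤ d-1 and 0 ≤ m, n ≤ d-c-1, the element R^{(c)}_{n,m} = ( {m}! · {2c+2n+1}!! · {2c+n+1}⁺! ) / ( {n}! · {2c+2m+1}!! · {2c+m+1}⁺! ) of ℚ(ζ) lies in O and is a unit of O. -/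
open Finset

/-- `x` is a unit of `ℤ[ζ]` times `(ζ - 1) ^ k`. -/
def IsUnitMulPow (ζ : ℂ) (k : ℕ) (x : ℂ) : Prop :=
  ∃ u : (Oring ζ)ˣ, x = ((u : Oring ζ) : ℂ) * (ζ - 1) ^ k

namespace IsUnitMulPow

variable {ζ x y : ℂ} {j k : ℕ}

theorem one (ζ : ℂ) : IsUnitMulPow ζ 0 1 := ⟨1, by simp⟩

theorem mul (hx : IsUnitMulPow ζ j x) (hy : IsUnitMulPow ζ k y) :
    IsUnitMulPow ζ (j + k) (x * y) := by
  obtain ⟨u, rfl⟩ := hx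
  obtain ⟨v, rfl⟩ := hy
  refine ⟨u * v, ?_⟩
  push_cast
  ring

theorem exists_unit_eq_div (hζ : ζ ≠ 1) (hx : IsUnitMulPow ζ k x) (hy : IsUnitMulPow ζ k y) :
    ∃ u : (Oring ζ)ˣ, ((u : Oring ζ) : ℂ) = x / y := by
  obtain ⟨u, rfl⟩ := hx
  obtain ⟨v, rfl⟩ := hy
  have h1 : ζ - 1 ≠ 0 := sub_ne_zero.mpr hζ
  have hv : ((v : Oring ζ) : ℂ) * (((v⁻¹ : (Oring ζ)ˣ) : Oring ζ) : ℂ) = 1 := by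
    rw [← Subring.coe_mul, Units.mul_inv, Subring.coe_one]
  have hv0 : ((v : Oring ζ) : ℂ) ≠ 0 := left_ne_zero_of_mul_eq_one hv
  refine ⟨u * v⁻¹, ?_⟩
  rw [mul_div_mul_right _ _ (pow_ne_zero k h1), eq_div_iff hv0]
  push_cast
  rw [mul_assoc, mul_comm _ ((v : Oring ζ) : ℂ), hv, mul_one]

theorem ne_zero (hζ : ζ ≠ 1) (hx : IsUnitMulPow ζ k x) : x ≠ 0 := by
  obtain ⟨u, hu⟩ := exists_unit_eq_div hζ hx hx
  rintro rfl
  simp at hu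

end IsUnitMulPow

section QuantumIntegers

variable {p : ℕ} {ζ A : ℂ}

theorem qint_two_mul (k : ℤ) : qint A (2 * k) = qint A k * qintp A k := by
  simp only [qint, qintp, two_mul, neg_add]
  rcases eq_or_ne A 0 with rfl | hA
  · rcases eq_or_ne k 0 with rfl | hk
    · simp
    · have h : -k + -k ≠ 0 := by lia
      have h' : k + k ≠ 0 := by lia
      simp [zero_zpow, hk, h, h']
  · rw [zpow_add₀ (neg_ne_zero.mpr hA), zpow_add₀ (neg_ne_zero.mpr hA)]
    ring

theorem neg_pow_half_sq (hp : p.Prime) (hp5 : 5 ≤ p) (hζ : IsPrimitiveRoot ζ p)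
    (hA : A = -ζ ^ ((p - 1) / 2 + 1)) : (-A) ^ 2 = ζ := by
  obtain ⟨d, hd⟩ := hp.odd_of_ne_two (by lia)
  have h : ((p - 1) / 2 + 1) * 2 = p + 1 := by lia
  rw [hA, neg_neg, ← pow_mul, h, pow_succ, hζ.pow_eq_one, one_mul]

theorem isUnitMulPow_qint (hp : p.Prime) (hp5 : 5 ≤ p) (hζ : IsPrimitiveRoot ζ p)
    (hA : A = -ζ ^ ((p - 1) / 2 + 1)) {k : ℕ} (hk : k.Coprime p) :
    IsUnitMulPow ζ 1 (qint A k) := by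
  have hmem : ζ ∈ Oring ζ := Subring.subset_closure rfl
  have hζ' : IsPrimitiveRoot (⟨ζ, hmem⟩ : Oring ζ) p :=
    IsPrimitiveRoot.of_map_of_injective (f := (Oring ζ).subtype) hζ Subtype.val_injective
  obtain ⟨u, hu⟩ := hζ'.associated_sub_one_pow_sub_one_of_coprime hk
  obtain ⟨v, hv⟩ := (hζ'.isUnit hp.ne_zero).pow (((p - 1) / 2 + 1) * k)
  have hu' : (ζ - 1) * ((u : Oring ζ) : ℂ) = ζ ^ k - 1 := congrArg Subtype.val hu
  have hv' : ((v : Oring ζ) : ℂ) = (-A) ^ k := by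
    rw [hv, hA, neg_neg, ← pow_mul]
    rfl
  have hvinv : ((v : Oring ζ) : ℂ) * (((v⁻¹ : (Oring ζ)ˣ) : Oring ζ) : ℂ) = 1 := by
    rw [← Subring.coe_mul, Units.mul_inv, Subring.coe_one]
  have hsq := neg_pow_half_sq hp hp5 hζ hA
  refine ⟨v⁻¹ * u, ?_⟩
  rw [qint, zpow_neg, zpow_natCast, ← hv', ← eq_inv_of_mul_eq_one_right hvinv]
  have hvv : ((v : Oring ζ) : ℂ) * ((v : Oring ζ) : ℂ) = ζ ^ k := by
    rw [hv', ← hsq, ← pow_mul, ← pow_add]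
    ring
  push_cast
  linear_combination (-(((v⁻¹ : (Oring ζ)ˣ) : Oring ζ) : ℂ)) * hu' +
    (((v⁻¹ : (Oring ζ)ˣ) : Oring ζ) : ℂ) * hvv - ((v : Oring ζ) : ℂ) * hvinv

theorem isUnitMulPow_qintp (hp : p.Prime) (hp5 : 5 ≤ p) (hζ : IsPrimitiveRoot ζ p)
    (hA : A = -ζ ^ ((p - 1) / 2 + 1)) {k : ℕ} (hk : k.Coprime p) :
    IsUnitMulPow ζ 0 (qintp A k) := by
  have hζ1 := hζ.ne_one hp.one_lt
  have h2 : (2 * k).Coprime p :=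
    Nat.Coprime.mul_left ((Nat.coprime_primes Nat.prime_two hp).mpr (by lia)) hk
  have hk1 := isUnitMulPow_qint hp hp5 hζ hA hk
  obtain ⟨u, hu⟩ := (isUnitMulPow_qint hp hp5 hζ hA h2).exists_unit_eq_div hζ1 hk1
  refine ⟨u, ?_⟩
  rw [hu, Nat.cast_mul, Nat.cast_two, qint_two_mul, mul_div_cancel_left₀ _ (hk1.ne_zero hζ1),
    pow_zero, mul_one]

theorem isUnitMulPow_qfact (hp : p.Prime) (hp5 : 5 ≤ p) (hζ : IsPrimitiveRoot ζ p)
    (hA : A = -ζ ^ ((p - 1) / 2 + 1)) {n : ℕ} (hn : n < p) :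
    IsUnitMulPow ζ n (qfact A n) := by
  induction n with
  | zero => simpa [qfact] using IsUnitMulPow.one ζ
  | succ n ih =>
    rw [qfact, prod_range_succ]
    have h := isUnitMulPow_qint hp hp5 hζ hA (Nat.coprime_of_lt_prime n.succ_ne_zero hn hp).symm
    exact (ih (by lia)).mul (by exact_mod_cast h)

theorem isUnitMulPow_qpfact (hp : p.Prime) (hp5 : 5 ≤ p) (hζ : IsPrimitiveRoot ζ p)
    (hA : A = -ζ ^ ((p - 1) / 2 + 1)) {n : ℕ} (hn : n < p) :
    IsUnitMulPow ζ 0 (qpfact A n) := by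
  induction n with
  | zero => simpa [qpfact] using IsUnitMulPow.one ζ
  | succ n ih =>
    rw [qpfact, prod_range_succ]
    have h := isUnitMulPow_qintp hp hp5 hζ hA (Nat.coprime_of_lt_prime n.succ_ne_zero hn hp).symm
    exact (ih (by lia)).mul (by exact_mod_cast h)

theorem isUnitMulPow_qdfact_odd (hp : p.Prime) (hp5 : 5 ≤ p) (hζ : IsPrimitiveRoot ζ p)
    (hA : A = -ζ ^ ((p - 1) / 2 + 1)) {n : ℕ} (hn : 2 * n + 1 < p) :
    IsUnitMulPow ζ (n + 1) (qdfact A (2 * n + 1)) := by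
  induction n with
  | zero => simpa [qdfact] using isUnitMulPow_qint hp hp5 hζ hA (Nat.coprime_one_left p)
  | succ n ih =>
    rw [show 2 * (n + 1) + 1 = 2 * n + 1 + 2 by ring, qdfact, mul_comm]
    have h := isUnitMulPow_qint hp hp5 hζ hA
      (Nat.coprime_of_lt_prime (n := 2 * n + 1 + 2) (by lia) (by lia) hp).symm
    exact (ih (by lia)).mul (by exact_mod_cast h)

end QuantumIntegers

/-- The ratio of Hopf-pairing norms
`R^{(c)}_{n,m} = ({m}!·{2c+2n+1}!!·{2c+n+1}⁺!)/({n}!·{2c+2m+1}!!·{2c+m+1}⁺!)`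
lies in `O = ℤ[ζ]` and is a unit of `O`. -/
theorem stmt7 (p : ℕ) (hp : p.Prime) (hp5 : 5 ≤ p) (ζ : ℂ)
    (hζ : IsPrimitiveRoot ζ p) (A : ℂ) (hA : A = -ζ ^ ((p - 1) / 2 + 1))
    (c m n : ℕ) (hc : c ≤ (p - 1) / 2 - 1)
    (hm : m ≤ (p - 1) / 2 - c - 1) (hn : n ≤ (p - 1) / 2 - c - 1) :
    ∃ u : (Oring ζ)ˣ,
      ((u : Oring ζ) : ℂ) =
        qfact A m * qdfact A (2 * c + 2 * n + 1) * qpfact A (2 * c + n + 1) /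
          (qfact A n * qdfact A (2 * c + 2 * m + 1) * qpfact A (2 * c + m + 1)) := by
  have key : ∀ a b : ℕ, a ≤ (p - 1) / 2 - c - 1 → b ≤ (p - 1) / 2 - c - 1 →
      IsUnitMulPow ζ (a + b + c + 1)
        (qfact A a * qdfact A (2 * c + 2 * b + 1) * qpfact A (2 * c + b + 1)) := by
    intro a b ha hb
    have h := ((isUnitMulPow_qfact hp hp5 hζ hA (n := a) (by lia)).mul
      (isUnitMulPow_qdfact_odd hp hp5 hζ hA (n := c + b) (by lia))).mul
      (isUnitMulPow_qpfact hp hp5 hζ hA (n := 2 * c + b + 1) (by lia))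
    convert h using 1
    · ring
    · rw [mul_add 2 c b]
  have hnm := key n m hn hm
  rw [add_comm n m] at hnm
  exact (key m n hm hn).exists_unit_eq_div (hζ.ne_one hp.one_lt) hnm
end

section
/- Let p be an odd prime and d = (p-1)/2. For every integer k with 0 ≤ k ≤ d-1, one has (d-k-1)! · (2k+1)!! ≡ (-2)^k · (d-1)! (mod p), i.e., this congruence of integers holds in ℤ/pℤ, where (2k+1)!! = 1·3·5···(2k+1) is the double factorial. -/
open Finset

/-- The double factorial of the odd number `2k+1`: `(2k+1)!! = 1·3·5⋯(2k+1)`. -/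
def oddDFact (k : ℕ) : ℕ := ∏ i ∈ Finset.range (k + 1), (2 * i + 1)

/-- If `2 (n + k) + 3` vanishes in a commutative ring, then
`n! (2k+1)!! = (-2)^k (n + k)!` there. -/
theorem factorial_mul_oddDFact {R : Type*} [CommRing R] (k n : ℕ)
    (h : (2 * (n + k) + 3 : R) = 0) :
    (n.factorial * oddDFact k : R) = (-2) ^ k * (n + k).factorial := by
  induction k generalizing n with
  | zero => simp [oddDFact]
  | succ k ih =>
    have hodd : oddDFact (k + 1) = oddDFact k * (2 * (k + 1) + 1) :=
      Finset.prod_range_succ _ _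
    have ih' := ih (n + 1) (by push_cast at h ⊢; linear_combination h)
    rw [show n + 1 + k = n + (k + 1) by ring, Nat.factorial_succ] at ih'
    rw [hodd]
    push_cast at h ih' ⊢
    linear_combination (-2) * ih' + (n.factorial * oddDFact k : R) * h

/-- Lemma at the end of Section 5: for `p` an odd prime, `d = (p-1)/2` and
`0 ≤ k ≤ d-1`, one has `(d-k-1)!·(2k+1)!! ≡ (-2)^k·(d-1)! (mod p)`. -/
theorem stmt9 (p : ℕ) (hp : p.Prime) (hodd : Odd p)
    (k : ℕ) (hk : k ≤ (p - 1) / 2 - 1) :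
    ((((p - 1) / 2 - k - 1).factorial * oddDFact k : ℕ) : ZMod p) =
      (-2 : ZMod p) ^ k * ((((p - 1) / 2 - 1).factorial : ℕ) : ZMod p) := by
  have hp2 := hp.two_le
  obtain ⟨m, hm⟩ := hodd
  obtain ⟨n, hn⟩ : ∃ n, p = 2 * (n + k) + 3 := ⟨m - 1 - k, by omega⟩
  have hzero : (2 * (n + k) + 3 : ZMod p) = 0 := by
    have hcast : ((2 * (n + k) + 3 : ℕ) : ZMod p) = 0 := hn ▸ CharP.cast_eq_zero (ZMod p) p
    exact_mod_cast hcast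
  rw [show (p - 1) / 2 - k - 1 = n by omega, show (p - 1) / 2 - 1 = n + k by omega]
  push_cast
  exact factorial_mul_oddDFact k n hzero
end

section
/- For all integers n, m with n ≥ m ≥ 1, the following identity holds in ℚ: ∑_{k=m}^{n} (-1)^{k+n} · k · C(k²-1, n-m) · C(2n, n-k) · C(k+m-1, k-m) = n·(2n-1)! / ( (n-m)! · (2m-1)! ), where C(a,b) denotes the binomial coefficient. -/
open Finset

open Polynomial in
/-- The central difference of order `2 * n` of `x ↦ P (x ^ 2)` at `0`, folded by symmetry. -/
theorem two_mul_sum_choose_mul_eval_sq {P : ℚ[X]} {n : ℕ} (hP : P.Monic)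
    (hdeg : P.natDegree = n) (h0 : P.eval 0 = 0) :
    2 * ∑ i ∈ Finset.range n, (-1 : ℚ) ^ (i + 1 + n) * ((2 * n).choose (n - (i + 1)) : ℚ) *
      P.eval (((i + 1 : ℕ) : ℚ) ^ 2) = ((2 * n).factorial : ℚ) := by
  have hQdeg : (P.comp (X ^ 2)).natDegree = 2 * n := by
    rw [natDegree_comp, natDegree_X_pow, hdeg, mul_comm]
  have hQ : (P.comp (X ^ 2)).Monic := hP.comp (monic_X_pow 2) (by simp)
  have key := congrFun (P.comp (X ^ 2)).fwdDiff_iter_degree_eq_factorial (-(n : ℚ))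
  rw [hQdeg, hQ.leadingCoeff, fwdDiff_iter_eq_sum_shift,
    show 2 * n + 1 = n + (1 + n) by ring, Finset.sum_range_add, Finset.sum_range_add,
    ← Finset.sum_range_reflect] at key
  simp only [Finset.sum_range_one, eval_comp, eval_pow, eval_X, nsmul_eq_mul, mul_one,
    zsmul_eq_mul, one_smul, Pi.natCast_apply, add_zero, neg_add_cancel, ne_eq,
    OfNat.ofNat_ne_zero, not_false_eq_true, zero_pow, h0, mul_zero, zero_add] at key
  rw [← key, two_mul]
  congr 1
  · refine Finset.sum_congr rfl fun i hi => ?_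
    obtain ⟨c, rfl⟩ : ∃ c, n = i + 1 + c := Nat.exists_eq_add_of_le (Finset.mem_range.mp hi)
    rw [show i + 1 + c - 1 - i = c by omega, show i + 1 + c - (i + 1) = c by omega,
      show 2 * (i + 1 + c) - c = i + 1 + (i + 1 + c) by omega]
    push_cast
    congr 2
    ring
  · refine Finset.sum_congr rfl fun i hi => ?_
    obtain ⟨c, rfl⟩ : ∃ c, n = i + 1 + c := Nat.exists_eq_add_of_le (Finset.mem_range.mp hi)
    rw [show i + 1 + c - (i + 1) = c by omega,
      show 2 * (i + 1 + c) - (i + 1 + c + (1 + i)) = c by omega,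
      ← Nat.choose_symm_of_eq_add
        (show 2 * (i + 1 + c) = i + 1 + c + (1 + i) + c by ring)]
    have hsign : (-1 : ℚ) ^ (i + 1 + (i + 1 + c)) = (-1) ^ c := by
      rw [show i + 1 + (i + 1 + c) = 2 * (i + 1) + c by ring, pow_add, pow_mul]
      simp
    push_cast
    rw [hsign]
    congr 2
    ring

theorem prod_sq_sub_sq_mul_factorial {k m : ℕ} (hm : 1 ≤ m) (hmk : m ≤ k) :
    (∏ j ∈ Finset.range m, ((k : ℚ) ^ 2 - (j : ℚ) ^ 2)) * ((k - m).factorial : ℚ) =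
      k * ((k + m - 1).factorial : ℚ) := by
  induction m, hm using Nat.le_induction with
  | base =>
    obtain ⟨c, rfl⟩ := Nat.exists_eq_add_of_le hmk
    rw [show 1 + c + 1 - 1 = c + 1 by omega, Nat.factorial_succ]
    simp
    ring
  | succ m hm ih =>
    obtain ⟨c, rfl⟩ := Nat.exists_eq_add_of_le hmk
    have ih := ih (by omega)
    rw [show m + 1 + c - m = c + 1 by omega, Nat.factorial_succ] at ih
    rw [Finset.prod_range_succ, show m + 1 + c - (m + 1) = c by omega,
      show m + 1 + c + (m + 1) - 1 = (m + 1 + c + m - 1) + 1 by omega, Nat.factorial_succ,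
      show m + 1 + c + m - 1 + 1 = m + 1 + c + m by omega]
    push_cast at ih ⊢
    linear_combination ((m : ℚ) + 1 + c + m) * ih

/-- The `i = 0` case of the combinatorial identity in the final Remark
(multiplied through by `n`): for `n ≥ m ≥ 1`,
`∑_{k=m}^{n} (-1)^{k+n}·k·C(k²-1,n-m)·C(2n,n-k)·C(k+m-1,k-m)
  = n·(2n-1)!/((n-m)!·(2m-1)!)`. -/
theorem stmt10 (n m : ℕ) (hm : 1 ≤ m) (hmn : m ≤ n) :
    ∑ k ∈ Finset.Icc m n,
        (-1 : ℚ) ^ (k + n) * (k : ℚ) * ((k ^ 2 - 1).choose (n - m) : ℚ) *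
          ((2 * n).choose (n - k) : ℚ) * ((k + m - 1).choose (k - m) : ℚ) =
      (n : ℚ) * ((2 * n - 1).factorial : ℚ) /
        (((n - m).factorial : ℚ) * ((2 * m - 1).factorial : ℚ)) := by
  have hQ : ((∏ j ∈ Finset.range m, (Polynomial.X - Polynomial.C ((j : ℚ) ^ 2)))).Monic :=
    Polynomial.monic_prod_X_sub_C _ _
  have hR : ((descPochhammer ℚ (n - m)).comp (Polynomial.X - Polynomial.C 1)).Monic :=
    (monic_descPochhammer ℚ (n - m)).comp (Polynomial.monic_X_sub_C 1)
      (by rw [Polynomial.natDegree_X_sub_C]; exact one_ne_zero)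
  have key := two_mul_sum_choose_mul_eval_sq (n := n) (hQ.mul hR)
    (by
      rw [hQ.natDegree_mul hR, Polynomial.natDegree_comp, descPochhammer_natDegree,
        Polynomial.natDegree_X_sub_C,
        Polynomial.natDegree_prod_of_monic _ _ fun j _ => Polynomial.monic_X_sub_C _]
      simp only [Polynomial.natDegree_X_sub_C, Finset.sum_const, Finset.card_range, smul_eq_mul,
        mul_one]
      omega)
    (by
      rw [Polynomial.eval_mul, Polynomial.eval_prod,
        Finset.prod_eq_zero (Finset.mem_range.mpr hm) (by simp), zero_mul])
  simp only [Polynomial.eval_mul, Polynomial.eval_prod, Polynomial.eval_comp, Polynomial.eval_sub,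
    Polynomial.eval_X, Polynomial.eval_C] at key
  rw [Finset.range_eq_Ico, Finset.sum_Ico_add' (fun k : ℕ =>
    (-1 : ℚ) ^ (k + n) * ((2 * n).choose (n - k) : ℚ) *
      ((∏ j ∈ Finset.range m, ((k : ℚ) ^ 2 - (j : ℚ) ^ 2)) *
        (descPochhammer ℚ (n - m)).eval ((k : ℚ) ^ 2 - 1))) 0 n 1, zero_add,
    Finset.Ico_add_one_right_eq_Icc,
    ← Finset.sum_subset (Finset.Icc_subset_Icc_left hm)] at key
  · have hfac : ((2 * n).factorial : ℚ) = 2 * (n * ((2 * n - 1).factorial : ℚ)) := by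
      rw [← Nat.mul_factorial_pred (show 2 * n ≠ 0 by omega)]
      push_cast
      ring
    rw [hfac] at key
    rw [eq_div_iff (by positivity), ← mul_left_cancel₀ two_ne_zero key, Finset.sum_mul]
    refine Finset.sum_congr rfl fun k hk => ?_
    obtain ⟨hmk, -⟩ := Finset.mem_Icc.mp hk
    have hpoch : (descPochhammer ℚ (n - m)).eval ((k : ℚ) ^ 2 - 1) =
        ((n - m).factorial : ℚ) * ((k ^ 2 - 1).choose (n - m) : ℚ) := by
      have hcast : (k : ℚ) ^ 2 - 1 = ((k ^ 2 - 1 : ℕ) : ℚ) := by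
        rw [Nat.cast_sub (Nat.one_le_pow _ _ (by omega))]
        simp
      rw [hcast, descPochhammer_eval_eq_descFactorial, Nat.descFactorial_eq_factorial_mul_choose]
      push_cast
      rfl
    have hchoose : ((k + m - 1).choose (k - m) : ℚ) * ((k - m).factorial : ℚ) *
        ((2 * m - 1).factorial : ℚ) = ((k + m - 1).factorial : ℚ) := by
      have := Nat.choose_mul_factorial_mul_factorial (show k - m ≤ k + m - 1 by omega)
      rw [show k + m - 1 - (k - m) = 2 * m - 1 by omega] at this
      exact_mod_cast this
    have hprod : ∏ j ∈ Finset.range m, ((k : ℚ) ^ 2 - (j : ℚ) ^ 2) =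
        k * ((k + m - 1).choose (k - m) : ℚ) * ((2 * m - 1).factorial : ℚ) := by
      refine mul_right_cancel₀ (b := ((k - m).factorial : ℚ)) (by positivity) ?_
      rw [prod_sq_sub_sq_mul_factorial hm hmk, ← hchoose]
      ring
    rw [hpoch, hprod]
    ring
  · intro k hk hk'
    rw [Finset.mem_Icc] at hk hk'
    rw [Finset.prod_eq_zero (Finset.mem_range.mpr (show k < m by omega)) (sub_self _), zero_mul,
      mul_zero]
end

section
/- For all integers n, m, i with n ≥ m ≥ 1 and i ≥ 1, one has ∑_{k=m}^{n} (-1)^{k+n} · k · C(k²-1, n-m-i) · C(2n, n-k) · C(k+m-1, k-m) = 0, where C(a,b) denotes the binomial coefficient, with the convention C(a,b) = 0 when b < 0. -/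
open Finset

/-- Binomial coefficient `C(a,b)` with an integer lower index, with the
convention that `C(a,b) = 0` when `b < 0`. -/
def binomZ (a : ℕ) (b : ℤ) : ℚ :=
  if 0 ≤ b then (a.choose b.toNat : ℚ) else 0

open Polynomial in
/-- A polynomial in `k ^ 2` of degree less than `n` vanishing at `0` is killed by the positive half
of the alternating central sum of order `2 * n`. -/
theorem sum_neg_one_pow_mul_choose_mul_eval_sq {n : ℕ} {Q : ℚ[X]} (hdeg : Q.natDegree < n)
    (h0 : Q.eval 0 = 0) :
    ∑ k ∈ Ico 1 (n + 1),
      (-1 : ℚ) ^ (k + n) * ((2 * n).choose (n - k) : ℚ) * Q.eval ((k : ℚ) ^ 2) = 0 := by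
  have hP : (Q.comp (X ^ 2)).natDegree < 2 * n := by
    rw [natDegree_comp, natDegree_X_pow]
    omega
  have h := congrFun (fwdDiff_iter_eq_zero_of_degree_lt hP) (-(n : ℚ))
  rw [fwdDiff_iter_eq_sum_shift, show 2 * n + 1 = n + 1 + n by ring, sum_range_add,
    sum_range_succ, ← sum_range_reflect] at h
  simp only [eval_comp, eval_pow, eval_X, nsmul_eq_mul, mul_one, neg_add_cancel, ne_eq,
    OfNat.ofNat_ne_zero, not_false_eq_true, zero_pow, h0, smul_zero, add_zero, Pi.zero_apply,
    zsmul_eq_mul] at h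
  have sign : ∀ a b : ℕ, a % 2 = b % 2 → (-1 : ℚ) ^ a = (-1) ^ b := fun a b hab ↦ by
    rw [neg_one_pow_eq_pow_mod_two, hab, ← neg_one_pow_eq_pow_mod_two]
  rw [sum_Ico_eq_sum_range, Nat.add_sub_cancel]
  have half : ∀ F G H : ℕ → ℚ, (∀ j ∈ range n, F j = H j) → (∀ j ∈ range n, G j = H j) →
      ∑ j ∈ range n, F j + ∑ j ∈ range n, G j = 0 → ∑ j ∈ range n, H j = 0 := by
    intro F G H hF hG hFG
    rw [sum_congr rfl hF, sum_congr rfl hG] at hFG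
    linarith
  refine half _ _ _ (fun j hj ↦ ?_) (fun j hj ↦ ?_) h
  all_goals
    rw [mem_range] at hj
    push_cast
  · rw [sign (2 * n - (n - 1 - j)) (1 + j + n) (by omega), show n - 1 - j = n - (1 + j) by omega,
      Nat.cast_sub (by omega : 1 + j ≤ n)]
    congr 2
    push_cast
    ring
  · rw [sign (2 * n - (n + 1 + j)) (1 + j + n) (by omega),
      Nat.choose_symm_of_eq_add (by omega : 2 * n = (n + 1 + j) + (n - (1 + j)))]
    congr 2
    ring

theorem mul_descFactorial_add_eq_prod (k s : ℕ) :
    (k : ℚ) * ((k + s).descFactorial (2 * s + 1) : ℚ) =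
      (k : ℚ) ^ 2 * ∏ j ∈ range s, ((k : ℚ) ^ 2 - ((j : ℚ) + 1) ^ 2) := by
  induction s with
  | zero => simp [sq]
  | succ s ih =>
    rw [prod_range_succ, ← mul_assoc, ← ih, show 2 * (s + 1) + 1 = (2 * s + 1 + 1) + 1 by ring,
      ← add_assoc, Nat.succ_descFactorial_succ, Nat.descFactorial_succ]
    rcases le_or_gt (s + 1) k with h | h
    · rw [show k + s - (2 * s + 1) = k - (s + 1) by omega]
      push_cast [Nat.cast_sub h]
      ring
    · rw [Nat.descFactorial_of_lt (by omega : k + s < 2 * s + 1)]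
      simp

/-- The `i > 0` case of the combinatorial identity in the final Remark
(multiplied through by `n`): for `n ≥ m ≥ 1` and `i ≥ 1`,
`∑_{k=m}^{n} (-1)^{k+n}·k·C(k²-1,n-m-i)·C(2n,n-k)·C(k+m-1,k-m) = 0`,
where `C(a,b) = 0` if `b < 0`. -/
theorem stmt11 (n m i : ℕ) (hm : 1 ≤ m) (hmn : m ≤ n) (hi : 1 ≤ i) :
    ∑ k ∈ Finset.Icc m n,
        (-1 : ℚ) ^ (k + n) * (k : ℚ) * binomZ (k ^ 2 - 1) ((n : ℤ) - m - i) *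
          ((2 * n).choose (n - k) : ℚ) * ((k + m - 1).choose (k - m) : ℚ) = 0 := by
  by_cases hr : (0 : ℤ) ≤ (n : ℤ) - m - i
  swap
  · simp only [binomZ, if_neg hr, mul_zero, zero_mul, sum_const_zero]
  obtain ⟨r, rfl⟩ : ∃ r, n = m + i + r := ⟨n - m - i, by omega⟩
  obtain ⟨s, rfl⟩ : ∃ s, m = s + 1 := ⟨m - 1, by omega⟩
  set n := s + 1 + i + r with hn
  have hr' : ((n : ℤ) - (s + 1 : ℕ) - i).toNat = r := by omega
  let A : Polynomial ℚ := ∏ j ∈ range s, (Polynomial.X - Polynomial.C (((j : ℚ) + 1) ^ 2))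
  let B : Polynomial ℚ := (descPochhammer ℚ r).comp (Polynomial.X - Polynomial.C 1)
  have hA : A.natDegree = s := by
    rw [Polynomial.natDegree_prod_of_monic _ _ fun j _ ↦ Polynomial.monic_X_sub_C _]
    simp only [Polynomial.natDegree_X_sub_C, sum_const, card_range, smul_eq_mul, mul_one]
  have hB : B.natDegree = r := by
    simp only [B, Polynomial.natDegree_comp, descPochhammer_natDegree,
      Polynomial.natDegree_X_sub_C, mul_one]
  have hdeg : (Polynomial.X * A * B).natDegree < n := by
    have h₁ := Polynomial.natDegree_mul_le (p := Polynomial.X * A) (q := B)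
    have h₂ := Polynomial.natDegree_mul_le (p := Polynomial.X) (q := A)
    rw [Polynomial.natDegree_X] at h₂
    omega
  have hAeval : ∀ k : ℕ, (k : ℚ) ^ 2 * A.eval ((k : ℚ) ^ 2) =
      k * ((k + s).choose (2 * s + 1) * (2 * s + 1).factorial) := fun k ↦ by
    have h := mul_descFactorial_add_eq_prod k s
    rw [Nat.descFactorial_eq_factorial_mul_choose] at h
    push_cast at h
    simp only [A, Polynomial.eval_prod, Polynomial.eval_sub, Polynomial.eval_X,
      Polynomial.eval_C]
    rw [← h]
    ring
  have hBeval : ∀ k : ℕ, 1 ≤ k →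
      B.eval ((k : ℚ) ^ 2) = (k ^ 2 - 1).choose r * r.factorial := fun k hk ↦ by
    have h : (k : ℚ) ^ 2 - 1 = ((k ^ 2 - 1 : ℕ) : ℚ) := by
      rw [Nat.cast_sub (Nat.one_le_pow _ _ hk)]
      simp
    simp only [B, Polynomial.eval_comp, Polynomial.eval_sub, Polynomial.eval_X,
      Polynomial.eval_C]
    rw [h, descPochhammer_eval_eq_descFactorial, Nat.descFactorial_eq_factorial_mul_choose]
    push_cast
    ring
  have key := sum_neg_one_pow_mul_choose_mul_eval_sq hdeg (by simp)
  simp only [Polynomial.eval_mul, Polynomial.eval_X] at key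
  have hc : ((2 * s + 1).factorial * r.factorial : ℚ) ≠ 0 := by positivity
  refine (mul_eq_zero.mp (?_ : ((2 * s + 1).factorial * r.factorial : ℚ) * _ = 0)).resolve_left hc
  rw [← key, mul_sum]
  refine sum_subset_zero_on_sdiff (fun k hk ↦ ?_) (fun k hk ↦ ?_) (fun k hk ↦ ?_)
  · simp only [mem_Icc, mem_Ico] at hk ⊢
    omega
  · simp only [mem_sdiff, mem_Icc, mem_Ico] at hk
    rw [hAeval k, Nat.choose_eq_zero_of_lt (by omega : k + s < 2 * s + 1)]
    simp
  · rw [mem_Icc] at hk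
    rw [hAeval k, hBeval k (by omega), binomZ, if_pos hr, hr',
      show k + (s + 1) - 1 = k + s by omega,
      Nat.choose_symm_of_eq_add (by omega : k + s = (k - (s + 1)) + (2 * s + 1))]
    ring
end

section
/- Let p ≥ 5 be prime, d = (p-1)/2, fix c with 0 ≤ c ≤ d-1 and set D = d-c-1. Define (D+1)×(D+1) matrices over ℤ/pℤ, indexed by 0 ≤ m, n ≤ D: Â with Â_{m,n} = (-1)^{n-m}·(2c+2n+1)!!·((n-m)!·(2c+2m+1)!!)^{-1} if m ≤ n and 0 otherwise; B̂ with B̂_{m,n} = C(m,n)·((-2)^{m-n})^{-1} if n ≤ m and 0 otherwise; α with α_{m,n} = C(n,m); β with β_{m,n} = (-1)^{m-n}·C(D-n, m-n) if n ≤ m and 0 otherwise; and the diagonal matrix Φ with Φ_{n,n} = (-1)^n·n!·((2c+2n+1)!!)^{-1}. (All the indicated inverses exist in ℤ/pℤ since the relevant factorials and double factorials involve only positive integers less than p, and -2 ≢ 0 mod p.) Then Â·Φ = Φ·α and B̂·Φ = Φ·β. -/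
open Finset Matrix

/-- The mod-`h` matrix `Â` of the twist `t` (Lemma 5.5):
`Â_{m,n} = (-1)^{n-m}·(2c+2n+1)!!·((n-m)!·(2c+2m+1)!!)⁻¹` for `m ≤ n`, else `0`. -/
def Ahat (p c D : ℕ) : Matrix (Fin (D + 1)) (Fin (D + 1)) (ZMod p) :=
  Matrix.of fun m n =>
    if (m : ℕ) ≤ (n : ℕ) then
      (-1 : ZMod p) ^ ((n : ℕ) - (m : ℕ)) * ((oddDFact (c + (n : ℕ)) : ℕ) : ZMod p) *
        (((((n : ℕ) - (m : ℕ)).factorial * oddDFact (c + (m : ℕ)) : ℕ)) : ZMod p)⁻¹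
    else 0

/-- The mod-`h` matrix `B̂` of the twist `t*` (Lemma 5.5):
`B̂_{m,n} = C(m,n)·((-2)^{m-n})⁻¹` for `n ≤ m`, else `0`. -/
def Bhat (p D : ℕ) : Matrix (Fin (D + 1)) (Fin (D + 1)) (ZMod p) :=
  Matrix.of fun m n =>
    if (n : ℕ) ≤ (m : ℕ) then
      ((Nat.choose (m : ℕ) (n : ℕ) : ℕ) : ZMod p) *
        ((-2 : ZMod p) ^ ((m : ℕ) - (n : ℕ)))⁻¹
    else 0

/-- The matrix `α` of `T = [[1,1],[0,1]]` on degree-`D` homogeneous polynomials: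
`α_{m,n} = C(n,m)`. -/
def alphaMat (p D : ℕ) : Matrix (Fin (D + 1)) (Fin (D + 1)) (ZMod p) :=
  Matrix.of fun m n => ((Nat.choose (n : ℕ) (m : ℕ) : ℕ) : ZMod p)

/-- The matrix `β` of `T* = [[1,0],[-1,1]]` on degree-`D` homogeneous polynomials:
`β_{m,n} = (-1)^{m-n}·C(D-n, m-n)` for `n ≤ m`, else `0`. -/
def betaMat (p D : ℕ) : Matrix (Fin (D + 1)) (Fin (D + 1)) (ZMod p) :=
  Matrix.of fun m n =>
    if (n : ℕ) ≤ (m : ℕ) then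
      (-1 : ZMod p) ^ ((m : ℕ) - (n : ℕ)) *
        ((Nat.choose (D - (n : ℕ)) ((m : ℕ) - (n : ℕ)) : ℕ) : ZMod p)
    else 0

/-- The diagonal intertwining matrix `Φ` with
`Φ_{n,n} = (-1)^n·n!·((2c+2n+1)!!)⁻¹`. -/
def PhiMat (p c D : ℕ) : Matrix (Fin (D + 1)) (Fin (D + 1)) (ZMod p) :=
  Matrix.diagonal fun n =>
    (-1 : ZMod p) ^ (n : ℕ) * (((n : ℕ).factorial : ℕ) : ZMod p) *
      (((oddDFact (c + (n : ℕ)) : ℕ)) : ZMod p)⁻¹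

theorem oddDFact_succ (k : ℕ) : oddDFact (k + 1) = oddDFact k * (2 * k + 3) := by
  simp only [oddDFact, Finset.prod_range_succ _ (k + 1)]
  ring

theorem oddDFact_cast_ne_zero {p : ℕ} (hp : p.Prime) {k : ℕ} (hk : 2 * k + 1 < p) :
    (oddDFact k : ZMod p) ≠ 0 := by
  rw [Ne, ZMod.natCast_eq_zero_iff, oddDFact, hp.prime.dvd_finsetProd_iff]
  rintro ⟨i, hi, hdvd⟩
  have := Nat.le_of_dvd (by omega) hdvd
  rw [Finset.mem_range] at hi
  omega

theorem factorial_cast_ne_zero {p : ℕ} (hp : p.Prime) {k : ℕ} (hk : k < p) :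
    (k.factorial : ZMod p) ≠ 0 := by
  rw [Ne, ZMod.natCast_eq_zero_iff, hp.dvd_factorial]
  omega

/-- Modulo `p = 2D + 2c + 3`, a quotient of odd double factorials is a descending factorial. -/
theorem oddDFact_cast_add {p c D : ℕ} (h : 2 * D + 2 * c + 3 = p) {n k : ℕ} (hk : n + k ≤ D) :
    (oddDFact (c + (n + k)) : ZMod p) =
      oddDFact (c + n) * (-2) ^ k * ((D - n).descFactorial k : ZMod p) := by
  induction k with
  | zero => simp
  | succ k ih =>
    have hz : (2 * D + 2 * c + 3 : ZMod p) = 0 := by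
      exact_mod_cast (congrArg (Nat.cast : ℕ → ZMod p) h).trans (ZMod.natCast_self p)
    rw [show c + (n + (k + 1)) = c + (n + k) + 1 by ring, oddDFact_succ, Nat.cast_mul,
      ih (by omega), Nat.descFactorial_succ, Nat.cast_mul, Nat.cast_sub (by omega : k ≤ D - n),
      Nat.cast_sub (by omega : n ≤ D)]
    push_cast
    linear_combination
      (oddDFact (c + n) * (-2) ^ k * ((D - n).descFactorial k : ZMod p)) * hz

theorem Ahat_mul_PhiMat {p c D : ℕ} (hp : p.Prime) (h : 2 * D + 2 * c + 3 = p) :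
    Ahat p c D * PhiMat p c D = PhiMat p c D * alphaMat p D := by
  have := Fact.mk hp
  ext ⟨m, hm⟩ ⟨n, hn⟩
  simp only [PhiMat, Matrix.mul_diagonal, Matrix.diagonal_mul, Ahat, alphaMat, Matrix.of_apply]
  split_ifs with hmn
  · obtain ⟨k, rfl⟩ := Nat.exists_eq_add_of_le hmn
    have h1 := oddDFact_cast_ne_zero hp (k := c + m) (by omega)
    have h2 := oddDFact_cast_ne_zero hp (k := c + (m + k)) (by omega)
    have h3 := factorial_cast_ne_zero hp (k := k) (by omega)
    have hch : ((m + k).choose m : ZMod p) * m.factorial * k.factorial = (m + k).factorial := by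
      rw [Nat.choose_symm_add, ← Nat.cast_mul, ← Nat.cast_mul,
        Nat.add_choose_mul_factorial_mul_factorial]
    have hs : (-1 : ZMod p) ^ k * (-1) ^ k = 1 := by rw [← mul_pow]; simp
    rw [Nat.add_sub_cancel_left, Nat.cast_mul, ← hch, pow_add]
    field_simp
    linear_combination ((m + k).choose m * m.factorial : ZMod p) * hs
  · rw [Nat.choose_eq_zero_of_lt (by omega)]
    simp

theorem Bhat_mul_PhiMat {p c D : ℕ} (hp : p.Prime) (h : 2 * D + 2 * c + 3 = p) :
    Bhat p D * PhiMat p c D = PhiMat p c D * betaMat p D := by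
  have := Fact.mk hp
  ext ⟨m, hm⟩ ⟨n, hn⟩
  simp only [PhiMat, Matrix.mul_diagonal, Matrix.diagonal_mul, Bhat, betaMat, Matrix.of_apply]
  split_ifs with hnm
  · obtain ⟨k, rfl⟩ := Nat.exists_eq_add_of_le hnm
    have h1 := oddDFact_cast_ne_zero hp (k := c + n) (by omega)
    have h2 := oddDFact_cast_ne_zero hp (k := c + (n + k)) (by omega)
    have htwo : (-2 : ZMod p) ^ k ≠ 0 := by
      refine pow_ne_zero _ (neg_ne_zero.mpr fun h0 => ?_)
      have := Nat.le_of_dvd two_pos ((ZMod.natCast_eq_zero_iff 2 p).mp (mod_cast h0))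
      omega
    have hch : ((n + k).choose n : ZMod p) * n.factorial * k.factorial = (n + k).factorial := by
      rw [Nat.choose_symm_add, ← Nat.cast_mul, ← Nat.cast_mul,
        Nat.add_choose_mul_factorial_mul_factorial]
    have hs : (-1 : ZMod p) ^ k * (-1) ^ k = 1 := by rw [← mul_pow]; simp
    have hodd := oddDFact_cast_add h (n := n) (k := k) (by omega)
    rw [Nat.descFactorial_eq_factorial_mul_choose, Nat.cast_mul] at hodd
    rw [Nat.add_sub_cancel_left, ← hch, pow_add]
    generalize (-2 : ZMod p) ^ k = t at *
    generalize (-1 : ZMod p) ^ k = s at *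
    generalize (-1 : ZMod p) ^ n = r at *
    rw [← div_eq_mul_inv, ← div_eq_mul_inv, ← div_eq_mul_inv, div_mul_div_comm, div_mul_eq_mul_div,
      div_eq_div_iff (mul_ne_zero htwo h1) h2, hodd]
    linear_combination (-((n + k).choose n : ZMod p) * r * n.factorial * oddDFact (c + n) * t *
      k.factorial * (D - n).choose k) * hs
  · simp

/-- The intertwining computation of Theorem 5.1: with `p ≥ 5` prime,
`d = (p-1)/2`, `0 ≤ c ≤ d-1` and `D = d-c-1`, one has `Â·Φ = Φ·α` and
`B̂·Φ = Φ·β`. -/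
theorem stmt12 (p : ℕ) (hp : p.Prime) (hp5 : 5 ≤ p)
    (c : ℕ) (hc : c ≤ (p - 1) / 2 - 1) :
    Ahat p c ((p - 1) / 2 - c - 1) * PhiMat p c ((p - 1) / 2 - c - 1) =
        PhiMat p c ((p - 1) / 2 - c - 1) * alphaMat p ((p - 1) / 2 - c - 1) ∧
    Bhat p ((p - 1) / 2 - c - 1) * PhiMat p c ((p - 1) / 2 - c - 1) =
        PhiMat p c ((p - 1) / 2 - c - 1) * betaMat p ((p - 1) / 2 - c - 1) := by
  have h : 2 * ((p - 1) / 2 - c - 1) + 2 * c + 3 = p := by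
    have := hp.eq_two_or_odd
    omega
  exact ⟨Ahat_mul_PhiMat hp h, Bhat_mul_PhiMat hp h⟩
end

section
/- Let p ≥ 5 be prime, d = (p-1)/2, ζ a primitive p-th root of unity, O = ℤ[ζ], A = -ζ^{d+1}. For 0 ≤ m ≤ d-1, the element γ_m = (-A)^{(m²+5m)/2} / ∏_{k=1}^{m}(A^{2k+1}-1) lies in O and satisfies 2^m·γ_m - (-1)^m ∈ (1-ζ)·O, i.e., 2^m γ_m ≡ (-1)^m modulo the ideal generated by h = 1-ζ. -/
open Finset

/-- `γ_m = (-A)^((m²+5m)/2) / ∏_{k=1}^{m}(A^(2k+1)-1)`. -/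
noncomputable def gammaCoef {F : Type*} [Field F] (A : F) (m : ℕ) : F :=
  (-A) ^ ((m ^ 2 + 5 * m) / 2) / ∏ k ∈ Finset.Icc 1 m, (A ^ (2 * k + 1) - 1)

/-- A nontrivial root of unity `ω` of odd order `2 * n + 1` makes `ω + 1` a unit, with an explicit
inverse in `ℤ[ω]`. -/
theorem add_one_mul_geom_sum_sq {F : Type*} [Field F] {ω : F} {n : ℕ}
    (hω : ω ^ (2 * n + 1) = 1) (hne : ω ≠ 1) :
    (ω + 1) * ∑ j ∈ Finset.range (n + 1), (ω ^ 2) ^ j = 1 := by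
  apply mul_left_cancel₀ (sub_ne_zero.mpr hne)
  have h := mul_geom_sum (ω ^ 2) (n + 1)
  have h2 : (ω ^ 2) ^ (n + 1) = ω := by
    rw [← pow_mul, show 2 * (n + 1) = 2 * n + 1 + 1 by ring, pow_succ, hω, one_mul]
  rw [h2] at h
  linear_combination h

theorem exists_inv_neg_pow_sub_one {F : Type*} [Field F] {R : Subring F} (z : R) {n t : ℕ}
    (hz : (z : F) ^ (2 * n + 1) = 1) (hne : (z : F) ^ t ≠ 1) :
    ∃ c : R, (c : F) = (-(z : F) ^ t - 1)⁻¹ ∧ 1 - z ∣ 2 * c - (-1) := by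
  have hω : ((z : F) ^ t) ^ (2 * n + 1) = 1 := by rw [pow_right_comm, hz, one_pow]
  have key := add_one_mul_geom_sum_sq hω hne
  let c : R := -∑ j ∈ Finset.range (n + 1), ((z ^ t) ^ 2) ^ j
  have hc : (c : F) * (-(z : F) ^ t - 1) = 1 := by
    simp only [c]
    push_cast
    linear_combination key
  have hcR : c * (-z ^ t - 1) = 1 := by
    apply Subtype.ext
    push_cast
    exact hc
  refine ⟨c, eq_inv_of_mul_eq_one_left hc, ?_⟩
  obtain ⟨y, hy⟩ := one_sub_dvd_one_sub_pow z t
  exact ⟨y * c, by linear_combination c * hy - hcR⟩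

theorem exists_prod_inv_neg_pow_sub_one {F : Type*} [Field F] {R : Subring F} (z : R) {n : ℕ}
    (hz : (z : F) ^ (2 * n + 1) = 1) (t : ℕ → ℕ) (m : ℕ)
    (hne : ∀ k ∈ Finset.Icc 1 m, (z : F) ^ t k ≠ 1) :
    ∃ c : R, (c : F) = (∏ k ∈ Finset.Icc 1 m, (-(z : F) ^ t k - 1))⁻¹ ∧
      1 - z ∣ 2 ^ m * c - (-1) ^ m := by
  induction m with
  | zero => exact ⟨1, by simp⟩
  | succ m ih =>
    obtain ⟨c, hc, y, hy⟩ := ih fun k hk =>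
      hne k (Finset.Icc_subset_Icc_right (Nat.le_succ m) hk)
    obtain ⟨c', hc', y', hy'⟩ := exists_inv_neg_pow_sub_one z hz (hne (m + 1) (by simp))
    refine ⟨c * c', ?_, y * (2 * c') + (-1) ^ m * y', ?_⟩
    · rw [Finset.prod_Icc_succ_top (by omega), mul_inv, Subring.coe_mul, hc, hc']
    · linear_combination 2 * c' * hy + (-1) ^ m * hy'

/-- The congruence `γ_m ≡ (-1)^m·2^{-m} mod h` used in the proof of Lemma 5.5:
`γ_m` lies in `O = ℤ[ζ]` and `2^m·γ_m - (-1)^m ∈ (1-ζ)·O`. -/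
theorem stmt14 (p : ℕ) (hp : p.Prime) (hp5 : 5 ≤ p) (ζ : ℂ)
    (hζ : IsPrimitiveRoot ζ p) (A : ℂ) (hA : A = -ζ ^ ((p - 1) / 2 + 1))
    (m : ℕ) (hm : m ≤ (p - 1) / 2 - 1) :
    gammaCoef A m ∈ Oring ζ ∧
    ∃ x : Oring ζ,
      (2 : ℂ) ^ m * gammaCoef A m - (-1 : ℂ) ^ m = (1 - ζ) * (x : ℂ) := by
  obtain ⟨d, rfl⟩ : Odd p := hp.odd_of_ne_two (by omega)
  rw [show (2 * d + 1 - 1) / 2 = d by omega] at hA hm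
  let z : Oring ζ := ⟨ζ, Subring.subset_closure rfl⟩
  have hne : ∀ k ∈ Finset.Icc 1 m, (z : ℂ) ^ ((d + 1) * (2 * k + 1)) ≠ 1 := by
    intro k hk h
    rw [Finset.mem_Icc] at hk
    rcases hp.dvd_mul.mp (hζ.dvd_of_pow_eq_one _ h) with h | h <;>
      have := Nat.le_of_dvd (by omega) h <;> omega
  obtain ⟨c, hc, y, hy⟩ := exists_prod_inv_neg_pow_sub_one z hζ.pow_eq_one _ m hne
  obtain ⟨w, hw⟩ := one_sub_dvd_one_sub_pow z ((d + 1) * ((m ^ 2 + 5 * m) / 2))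
  have hγ : gammaCoef A m = ((z ^ ((d + 1) * ((m ^ 2 + 5 * m) / 2)) * c : Oring ζ) : ℂ) := by
    have hprod : ∏ k ∈ Finset.Icc 1 m, (A ^ (2 * k + 1) - 1) =
        ∏ k ∈ Finset.Icc 1 m, (-(z : ℂ) ^ ((d + 1) * (2 * k + 1)) - 1) :=
      Finset.prod_congr rfl fun k _ => by
        rw [hA, Odd.neg_pow ⟨k, rfl⟩, ← pow_mul]
    rw [gammaCoef, hprod, div_eq_mul_inv, ← hc, hA, neg_neg, ← pow_mul]
    push_cast
    rfl
  refine ⟨hγ ▸ Subtype.property _, y - 2 ^ m * c * w, ?_⟩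
  have hR : 2 ^ m * (z ^ ((d + 1) * ((m ^ 2 + 5 * m) / 2)) * c) - (-1) ^ m =
      (1 - z) * (y - 2 ^ m * c * w) := by
    linear_combination hy - 2 ^ m * c * hw
  rw [hγ]
  have h := congrArg (Oring ζ).subtype hR
  rw [map_sub, map_mul _ (2 ^ m), map_mul _ (1 - z), map_sub _ 1 z, map_pow _ 2, map_pow _ (-1),
    map_ofNat, map_neg, map_one] at h
  exact h
end

section
/- Let p ≥ 5 be prime, d = (p-1)/2, ζ a primitive p-th root of unity, O = ℤ[ζ], h = 1-ζ, A = -ζ^{d+1}. Let 0 ≤ c ≤ d-1 and 0 ≤ m ≤ n ≤ d-c-1. With b^{(c)}_{n,m} = ∑_{l=0}^{m+c} C^{l}_{l+n-m, m+c}·(γ_{l+n-m}/{l+n-m}!)·({n}!/{m}!) and R^{(c)}_{n,m} = ({m}!·{2c+2n+1}!!·{2c+n+1}⁺!)/({n}!·{2c+2m+1}!!·{2c+m+1}⁺!), define a^{(c)}_{m,n} = R^{(c)}_{n,m}·b^{(c)}_{n,m} ∈ ℚ(ζ). Then a^{(c)}_{m,n} lies in O and (n-m)!·(2c+2m+1)!!·a^{(c)}_{m,n}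 - (-1)^{n-m}·(2c+2n+1)!! ∈ (1-ζ)·O, where (n-m)! and the double factorials (2c+2m+1)!!, (2c+2n+1)!! are ordinary integers. -/
open Finset

/-- The matrix coefficient `b^{(c)}_{n,m} = ∑_{l=0}^{m+c} C^l_{l+n-m, m+c}·
(γ_{l+n-m}/{l+n-m}!)·({n}!/{m}!)` of the twist map `t*` (Theorem 4.8). -/
noncomputable def bCoef {F : Type*} [Field F] (A : F) (c n m : ℕ) : F :=
  ∑ l ∈ Finset.range (m + c + 1),
    Ccoef A l (l + n - m) (m + c) * (gammaCoef A (l + n - m) / qfact A (l + n - m)) *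
      (qfact A n / qfact A m)

/-- The ratio of Hopf-pairing norms
`R^{(c)}_{n,m} = ({m}!·{2c+2n+1}!!·{2c+n+1}⁺!)/({n}!·{2c+2m+1}!!·{2c+m+1}⁺!)`. -/
noncomputable def Rcoef {F : Type*} [Field F] (A : F) (c n m : ℕ) : F :=
  qfact A m * qdfact A (2 * c + 2 * n + 1) * qpfact A (2 * c + n + 1) /
    (qfact A n * qdfact A (2 * c + 2 * m + 1) * qpfact A (2 * c + m + 1))

/-- The matrix coefficient `a^{(c)}_{m,n} = R^{(c)}_{n,m}·b^{(c)}_{n,m}` of the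
twist map `t` (Theorem 4.8 via equation (4.1)). -/
noncomputable def aCoef {F : Type*} [Field F] (A : F) (c m n : ℕ) : F :=
  Rcoef A c n m * bCoef A c n m

section Congruence

variable {F : Type*} [Field F]

/-- The elements of the field `F` that are units of the subring `S`. -/
def unitsIn (S : Subring F) : Submonoid F where
  carrier := {x | x ≠ 0 ∧ x ∈ S ∧ x⁻¹ ∈ S}
  one_mem' := ⟨one_ne_zero, S.one_mem, by simp [S.one_mem]⟩
  mul_mem' := by
    rintro a b ⟨ha, ha1, ha2⟩ ⟨hb, hb1, hb2⟩
    exact ⟨mul_ne_zero ha hb, S.mul_mem ha1 hb1, by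
      rw [mul_inv]; exact S.mul_mem ha2 hb2⟩

/-- Congruence modulo the principal ideal `h S` between elements of the subring `S`. -/
structure CongMod (S : Subring F) (h x y : F) : Prop where
  left_mem : x ∈ S
  right_mem : y ∈ S
  exists_eq : ∃ z ∈ S, x - y = h * z

variable {S : Subring F} {h x y z x' y' : F}

lemma unitsIn_neg (hx : x ∈ unitsIn S) : -x ∈ unitsIn S :=
  ⟨neg_ne_zero.mpr hx.1, S.neg_mem hx.2.1, by rw [inv_neg]; exact S.neg_mem hx.2.2⟩

namespace CongMod

lemma refl (hx : x ∈ S) : CongMod S h x x := ⟨hx, hx, 0, S.zero_mem, by simp⟩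

lemma symm (H : CongMod S h x y) : CongMod S h y x := by
  obtain ⟨hx, hy, z, hz, e⟩ := H
  exact ⟨hy, hx, -z, S.neg_mem hz, by linear_combination -e⟩

lemma trans (H : CongMod S h x y) (H' : CongMod S h y z) : CongMod S h x z := by
  obtain ⟨hx, hy, z, hz, e⟩ := H
  obtain ⟨hx', hy', z', hz', e'⟩ := H'
  exact ⟨hx, hy', z + z', S.add_mem hz hz', by linear_combination e + e'⟩

lemma add (H : CongMod S h x y) (H' : CongMod S h x' y') : CongMod S h (x + x') (y + y') := by
  obtain ⟨hx, hy, z, hz, e⟩ := H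
  obtain ⟨hx', hy', z', hz', e'⟩ := H'
  exact ⟨S.add_mem hx hx', S.add_mem hy hy', z + z', S.add_mem hz hz',
    by linear_combination e + e'⟩

lemma mul (H : CongMod S h x y) (H' : CongMod S h x' y') : CongMod S h (x * x') (y * y') := by
  obtain ⟨hx, hy, z, hz, e⟩ := H
  obtain ⟨hx', hy', z', hz', e'⟩ := H'
  exact ⟨S.mul_mem hx hx', S.mul_mem hy hy', z * x' + y * z',
    S.add_mem (S.mul_mem hz hx') (S.mul_mem hy hz'), by linear_combination e * x' + y * e'⟩

lemma neg (H : CongMod S h x y) : CongMod S h (-x) (-y) := by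
  simpa using (refl (S.neg_mem S.one_mem)).mul H

lemma prod {ι : Type*} (s : Finset ι) {f g : ι → F} (H : ∀ i ∈ s, CongMod S h (f i) (g i)) :
    CongMod S h (∏ i ∈ s, f i) (∏ i ∈ s, g i) := by
  classical
  induction s using Finset.induction_on with
  | empty => simpa using refl S.one_mem
  | insert a s ha ih =>
    rw [prod_insert ha, prod_insert ha]
    exact (H a (mem_insert_self a s)).mul (ih fun i hi => H i (mem_insert_of_mem hi))

lemma sum {ι : Type*} (s : Finset ι) {f g : ι → F} (H : ∀ i ∈ s, CongMod S h (f i) (g i)) :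
    CongMod S h (∑ i ∈ s, f i) (∑ i ∈ s, g i) := by
  classical
  induction s using Finset.induction_on with
  | empty => simpa using refl S.zero_mem
  | insert a s ha ih =>
    rw [sum_insert ha, sum_insert ha]
    exact (H a (mem_insert_self a s)).add (ih fun i hi => H i (mem_insert_of_mem hi))

lemma pow (H : CongMod S h x y) (n : ℕ) : CongMod S h (x ^ n) (y ^ n) := by
  simpa using prod (range n) fun _ _ => H

end CongMod

end Congruence

section RootOfUnity

variable {F : Type*} [Field F] {S : Subring F} {q : F} {p : ℕ}

/-- Ratios of cyclotomic differences are cyclotomic integers. -/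
lemma pow_sub_one_div_mem (hq : IsPrimitiveRoot q p) (hqS : q ∈ S) (hp : p.Prime) {a b : ℕ}
    (hb : b.Coprime p) : (q ^ a - 1) / (q ^ b - 1) ∈ S := by
  have hqb := hq.pow_of_coprime b hb
  have : NeZero p := ⟨hp.ne_zero⟩
  obtain ⟨j, -, hj⟩ := hqb.eq_pow_of_pow_eq_one
    (show (q ^ a) ^ p = 1 by rw [← pow_mul, mul_comm, pow_mul, hq.pow_eq_one, one_pow])
  have h1 : q ^ b - 1 ≠ 0 := sub_ne_zero.mpr (hqb.ne_one hp.one_lt)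
  rw [← hj, ← geom_sum_mul, mul_div_cancel_right₀ _ h1]
  exact S.sum_mem fun i _ => S.pow_mem (S.pow_mem hqS _) _

lemma pow_sub_one_div_mem_unitsIn (hq : IsPrimitiveRoot q p) (hqS : q ∈ S) (hp : p.Prime)
    {a b : ℕ} (ha : a.Coprime p) (hb : b.Coprime p) :
    (q ^ a - 1) / (q ^ b - 1) ∈ unitsIn S := by
  refine ⟨div_ne_zero ?_ ?_, pow_sub_one_div_mem hq hqS hp hb, ?_⟩
  · exact sub_ne_zero.mpr ((hq.pow_of_coprime a ha).ne_one hp.one_lt)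
  · exact sub_ne_zero.mpr ((hq.pow_of_coprime b hb).ne_one hp.one_lt)
  · rw [inv_div]
    exact pow_sub_one_div_mem hq hqS hp ha

lemma root_mem_unitsIn (hq : IsPrimitiveRoot q p) (hqS : q ∈ S) (hp : p.Prime) :
    q ∈ unitsIn S := by
  refine ⟨hq.ne_zero hp.ne_zero, hqS, ?_⟩
  have : q⁻¹ = q ^ (p - 1) := inv_eq_of_mul_eq_one_right (by
    rw [← pow_succ', Nat.sub_add_cancel hp.one_le, hq.pow_eq_one])
  rw [this]
  exact S.pow_mem hqS _

lemma two_coprime (hp : p.Prime) (hp2 : p ≠ 2) : Nat.Coprime 2 p :=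
  (Nat.coprime_primes Nat.prime_two hp).mpr hp2.symm

lemma one_add_pow_mem_unitsIn (hq : IsPrimitiveRoot q p) (hqS : q ∈ S) (hp : p.Prime)
    (hp2 : p ≠ 2) {k : ℕ} (hk : k.Coprime p) : 1 + q ^ k ∈ unitsIn S := by
  have h1 : q ^ k - 1 ≠ 0 := sub_ne_zero.mpr ((hq.pow_of_coprime k hk).ne_one hp.one_lt)
  have h2 : 1 + q ^ k = (q ^ (2 * k) - 1) / (q ^ k - 1) := by
    rw [eq_div_iff h1]; ring
  rw [h2]
  exact pow_sub_one_div_mem_unitsIn hq hqS hp ((two_coprime hp hp2).mul_left hk) hk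

lemma root_cong_one (hq : IsPrimitiveRoot q p) (hqS : q ∈ S) (hp : p.Prime) (hp2 : p ≠ 2) :
    CongMod S (1 - q ^ 2) q 1 := by
  have H := one_add_pow_mem_unitsIn hq hqS hp hp2 (Nat.coprime_one_left p)
  rw [pow_one] at H
  refine ⟨hqS, S.one_mem, -(1 + q)⁻¹, S.neg_mem H.2.2, ?_⟩
  have := H.1
  field_simp
  ring

lemma root_inv_cong_one (hq : IsPrimitiveRoot q p) (hqS : q ∈ S) (hp : p.Prime) (hp2 : p ≠ 2) :
    CongMod S (1 - q ^ 2) q⁻¹ 1 := by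
  have H := root_mem_unitsIn hq hqS hp
  simpa [H.1] using ((CongMod.refl H.2.2).mul (root_cong_one hq hqS hp hp2)).symm

lemma one_add_pow_cong (hq : IsPrimitiveRoot q p) (hqS : q ∈ S) (hp : p.Prime) (hp2 : p ≠ 2)
    (k : ℕ) : CongMod S (1 - q ^ 2) (1 + q ^ k) 2 := by
  have := (CongMod.refl (h := 1 - q ^ 2) S.one_mem).add ((root_cong_one hq hqS hp hp2).pow k)
  rwa [one_pow, one_add_one_eq_two] at this

/-- Powers of two can be cancelled modulo `1 - q ^ 2`. -/
lemma CongMod.cancel_two_pow (hq : IsPrimitiveRoot q p) (hqS : q ∈ S) (hp : p.Prime)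
    (hp2 : p ≠ 2) {x y : F} (hx : x ∈ S) (hy : y ∈ S) (N : ℕ)
    (H : CongMod S (1 - q ^ 2) (2 ^ N * x) (2 ^ N * y)) : CongMod S (1 - q ^ 2) x y := by
  have hu := one_add_pow_mem_unitsIn hq hqS hp hp2 (Nat.coprime_one_left p)
  have h2 := one_add_pow_cong hq hqS hp hp2 1
  set u := 1 + q ^ 1
  have h1 : CongMod S (1 - q ^ 2) (u⁻¹ * 2) 1 := by
    simpa [hu.1] using ((CongMod.refl hu.2.2).mul h2).symm
  have h3 : ∀ {z : F}, z ∈ S → CongMod S (1 - q ^ 2) (u⁻¹ ^ N * (2 ^ N * z)) z := by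
    intro z hz
    simpa [mul_pow, mul_assoc] using (h1.pow N).mul (CongMod.refl hz)
  exact ((h3 hx).symm.trans ((CongMod.refl (S.pow_mem hu.2.2 N)).mul H)).trans (h3 hy)

end RootOfUnity

section QuantumIntegers

variable {F : Type*} [Field F] {S : Subring F} {q : F} {p : ℕ}

/-- The quantum integer `{k}` at `A = -q`, divided by `1 - q ^ 2`. -/
noncomputable def qunit (q : F) (k : ℕ) : F := qint (-q) k / (1 - q ^ 2)

lemma qint_eq (hq0 : q ≠ 0) (k : ℕ) : qint (-q) k = q⁻¹ ^ k * (q ^ (2 * k) - 1) := by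
  simp only [qint, neg_neg, zpow_natCast, zpow_neg, inv_pow]
  field_simp
  ring

lemma qintp_eq (hq0 : q ≠ 0) (k : ℕ) : qintp (-q) k = q⁻¹ ^ k * (1 + q ^ (2 * k)) := by
  simp only [qintp, neg_neg, zpow_natCast, zpow_neg, inv_pow]
  field_simp
  ring

lemma one_sub_sq_ne_zero (hq : IsPrimitiveRoot q p) (hp : p.Prime) (hp2 : p ≠ 2) :
    1 - q ^ 2 ≠ 0 :=
  sub_ne_zero.mpr ((hq.pow_of_coprime 2 (two_coprime hp hp2)).ne_one hp.one_lt).symm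

lemma qint_eq_mul_qunit (hq : IsPrimitiveRoot q p) (hp : p.Prime) (hp2 : p ≠ 2) (k : ℕ) :
    qint (-q) k = (1 - q ^ 2) * qunit q k := by
  rw [qunit, mul_div_cancel₀ _ (one_sub_sq_ne_zero hq hp hp2)]

lemma qunit_mem_unitsIn (hq : IsPrimitiveRoot q p) (hqS : q ∈ S) (hp : p.Prime) (hp2 : p ≠ 2)
    {k : ℕ} (hk : k.Coprime p) : qunit q k ∈ unitsIn S := by
  have H := root_mem_unitsIn hq hqS hp
  have Hi : q⁻¹ ∈ unitsIn S := ⟨inv_ne_zero H.1, H.2.2, by rw [inv_inv]; exact H.2.1⟩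
  have e : qunit q k = -(q⁻¹ ^ k * ((q ^ (2 * k) - 1) / (q ^ 2 - 1))) := by
    rw [qunit, qint_eq H.1, ← neg_sub (q ^ 2) 1, div_neg, mul_div_assoc]
  rw [e]
  exact unitsIn_neg ((unitsIn S).mul_mem ((unitsIn S).pow_mem Hi _)
    (pow_sub_one_div_mem_unitsIn hq hqS hp ((two_coprime hp hp2).mul_left hk)
      (two_coprime hp hp2)))

lemma qunit_cong (hq : IsPrimitiveRoot q p) (hqS : q ∈ S) (hp : p.Prime) (hp2 : p ≠ 2)
    (k : ℕ) : CongMod S (1 - q ^ 2) (qunit q k) (-(k : F)) := by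
  have H := root_mem_unitsIn hq hqS hp
  have h0 : q ^ 2 - 1 ≠ 0 := by
    rw [← neg_sub]; exact neg_ne_zero.mpr (one_sub_sq_ne_zero hq hp hp2)
  have e : qunit q k = -(q⁻¹ ^ k * ∑ i ∈ range k, (q ^ 2) ^ i) := by
    rw [qunit, qint_eq H.1, ← neg_sub (q ^ 2) 1, div_neg, mul_div_assoc, pow_mul,
      ← geom_sum_mul, mul_div_cancel_right₀ _ h0]
  rw [e]
  have h1 := (root_inv_cong_one hq hqS hp hp2).pow k
  have h2 := CongMod.sum (range k) fun i _ => ((root_cong_one hq hqS hp hp2).pow 2).pow i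
  simpa using (h1.mul h2).neg

/-- The quantum factorial divided by its power of `1 - q ^ 2`. -/
noncomputable def ufact (q : F) (n : ℕ) : F := ∏ k ∈ range n, qunit q (k + 1)

/-- The quantum double factorial of `2 k + 1` divided by its power of `1 - q ^ 2`. -/
noncomputable def uodd (q : F) (k : ℕ) : F := ∏ i ∈ range (k + 1), qunit q (2 * i + 1)

lemma qfact_eq (hq : IsPrimitiveRoot q p) (hp : p.Prime) (hp2 : p ≠ 2) (n : ℕ) :
    qfact (-q) n = (1 - q ^ 2) ^ n * ufact q n := by
  have : ∀ k : ℕ, qint (-q) ((k : ℤ) + 1) = (1 - q ^ 2) * qunit q (k + 1) := fun k => by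
    rw [← qint_eq_mul_qunit hq hp hp2]; push_cast; rfl
  simp [qfact, ufact, this, prod_mul_distrib]

lemma qdfact_eq (hq : IsPrimitiveRoot q p) (hp : p.Prime) (hp2 : p ≠ 2) (k : ℕ) :
    qdfact (-q) (2 * k + 1) = (1 - q ^ 2) ^ (k + 1) * uodd q k := by
  induction k with
  | zero =>
    simpa [qdfact, uodd] using qint_eq_mul_qunit hq hp hp2 1
  | succ k ih =>
    have e : uodd q (k + 1) = uodd q k * qunit q (2 * k + 1 + 2) := prod_range_succ _ _
    have h := qint_eq_mul_qunit hq hp hp2 (2 * k + 1 + 2)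
    rw [show 2 * (k + 1) + 1 = 2 * k + 1 + 2 by ring, qdfact, ih, e]
    rw [Nat.cast_add (2 * k + 1) 2, Nat.cast_two] at h
    rw [h]
    ring

lemma coprime_of_pos_of_lt (hp : p.Prime) {k : ℕ} (h0 : 0 < k) (hk : k < p) : k.Coprime p :=
  (Nat.coprime_of_lt_prime h0.ne' hk hp).symm

lemma ufact_mem_unitsIn (hq : IsPrimitiveRoot q p) (hqS : q ∈ S) (hp : p.Prime) (hp2 : p ≠ 2)
    {n : ℕ} (hn : n < p) : ufact q n ∈ unitsIn S :=
  (unitsIn S).prod_mem fun k hk => qunit_mem_unitsIn hq hqS hp hp2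
    (coprime_of_pos_of_lt hp k.succ_pos (by have := mem_range.mp hk; omega))

lemma uodd_mem_unitsIn (hq : IsPrimitiveRoot q p) (hqS : q ∈ S) (hp : p.Prime) (hp2 : p ≠ 2)
    {k : ℕ} (hk : 2 * k + 1 < p) : uodd q k ∈ unitsIn S :=
  (unitsIn S).prod_mem fun i hi => qunit_mem_unitsIn hq hqS hp hp2
    (coprime_of_pos_of_lt hp (Nat.succ_pos _) (by have := mem_range.mp hi; omega))

lemma qpfact_mem_unitsIn (hq : IsPrimitiveRoot q p) (hqS : q ∈ S) (hp : p.Prime) (hp2 : p ≠ 2)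
    {n : ℕ} (hn : n < p) : qpfact (-q) n ∈ unitsIn S := by
  have H := root_mem_unitsIn hq hqS hp
  have Hi : q⁻¹ ∈ unitsIn S := ⟨inv_ne_zero H.1, H.2.2, by rw [inv_inv]; exact H.2.1⟩
  refine (unitsIn S).prod_mem fun k hk => ?_
  have hk' := mem_range.mp hk
  rw [← Nat.cast_succ, qintp_eq H.1]
  exact (unitsIn S).mul_mem ((unitsIn S).pow_mem Hi _)
    (one_add_pow_mem_unitsIn hq hqS hp hp2 ((two_coprime hp hp2).mul_left
      (coprime_of_pos_of_lt hp k.succ_pos (by omega))))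

lemma ufact_cong (hq : IsPrimitiveRoot q p) (hqS : q ∈ S) (hp : p.Prime) (hp2 : p ≠ 2)
    (n : ℕ) : CongMod S (1 - q ^ 2) (ufact q n) ((-1) ^ n * (n.factorial : F)) := by
  have h := CongMod.prod (range n) fun k _ => qunit_cong hq hqS hp hp2 (k + 1)
  rw [prod_neg, card_range, ← Nat.cast_prod, prod_range_add_one_eq_factorial] at h
  exact h

lemma uodd_cong (hq : IsPrimitiveRoot q p) (hqS : q ∈ S) (hp : p.Prime) (hp2 : p ≠ 2)
    (k : ℕ) : CongMod S (1 - q ^ 2) (uodd q k) ((-1) ^ (k + 1) * (oddDFact k : F)) := by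
  have h := CongMod.prod (range (k + 1)) fun i _ => qunit_cong hq hqS hp hp2 (2 * i + 1)
  rw [prod_neg, card_range, ← Nat.cast_prod] at h
  exact h

lemma qpfact_cong (hq : IsPrimitiveRoot q p) (hqS : q ∈ S) (hp : p.Prime) (hp2 : p ≠ 2)
    (n : ℕ) : CongMod S (1 - q ^ 2) (qpfact (-q) n) (2 ^ n) := by
  have h : ∀ k : ℕ, CongMod S (1 - q ^ 2) (qintp (-q) ((k : ℤ) + 1)) 2 := fun k => by
    rw [← Nat.cast_succ, qintp_eq (hq.ne_zero hp.ne_zero)]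
    simpa using ((root_inv_cong_one hq hqS hp hp2).pow (k + 1)).mul
      (one_add_pow_cong hq hqS hp hp2 (2 * (k + 1)))
  simpa [qpfact] using CongMod.prod (range n) fun k _ => h k

lemma neg_pow_sub_one (q : F) (k : ℕ) : (-q) ^ (2 * k + 1) - 1 = -(1 + q ^ (2 * k + 1)) := by
  rw [Odd.neg_pow ⟨k, rfl⟩]; ring

lemma gammaCoef_denom_mem_unitsIn (hq : IsPrimitiveRoot q p) (hqS : q ∈ S) (hp : p.Prime)
    (hp2 : p ≠ 2) {m : ℕ} (hm : 2 * m + 1 < p) :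
    ∏ k ∈ Icc 1 m, ((-q) ^ (2 * k + 1) - 1) ∈ unitsIn S := by
  refine (unitsIn S).prod_mem fun k hk => ?_
  have hk' := mem_Icc.mp hk
  rw [neg_pow_sub_one]
  exact unitsIn_neg (one_add_pow_mem_unitsIn hq hqS hp hp2
    (coprime_of_pos_of_lt hp (Nat.succ_pos _) (by omega)))

lemma gammaCoef_denom_cong (hq : IsPrimitiveRoot q p) (hqS : q ∈ S) (hp : p.Prime)
    (hp2 : p ≠ 2) (m : ℕ) :
    CongMod S (1 - q ^ 2) (∏ k ∈ Icc 1 m, ((-q) ^ (2 * k + 1) - 1)) ((-2) ^ m) := by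
  have h : ∀ k : ℕ, CongMod S (1 - q ^ 2) ((-q) ^ (2 * k + 1) - 1) (-2) := fun k => by
    rw [neg_pow_sub_one]
    exact (one_add_pow_cong hq hqS hp hp2 _).neg
  simpa using CongMod.prod (Icc 1 m) fun k _ => h k

lemma gammaCoef_mem (hq : IsPrimitiveRoot q p) (hqS : q ∈ S) (hp : p.Prime)
    (hp2 : p ≠ 2) {m : ℕ} (hm : 2 * m + 1 < p) : gammaCoef (-q) m ∈ S := by
  rw [gammaCoef, neg_neg, div_eq_mul_inv]
  exact S.mul_mem (S.pow_mem hqS _) (gammaCoef_denom_mem_unitsIn hq hqS hp hp2 hm).2.2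

lemma gammaCoef_mul_denom_cong (hq : IsPrimitiveRoot q p) (hqS : q ∈ S) (hp : p.Prime)
    (hp2 : p ≠ 2) {m : ℕ} (hm : 2 * m + 1 < p) :
    CongMod S (1 - q ^ 2)
      (gammaCoef (-q) m * ∏ k ∈ Icc 1 m, ((-q) ^ (2 * k + 1) - 1)) 1 := by
  rw [gammaCoef, neg_neg, div_mul_cancel₀ _ (gammaCoef_denom_mem_unitsIn hq hqS hp hp2 hm).1]
  simpa using (root_cong_one hq hqS hp hp2).pow ((m ^ 2 + 5 * m) / 2)

end QuantumIntegers

section TwistCoefficient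

variable {F : Type*} [Field F] {S : Subring F} {q : F} {p : ℕ}

/-- The sum over `l` in `b^{(c)}_{m+r,m}`, with the common factor `{m+r}! / ({m}! {r}!)` removed
and the powers of `1 - q ^ 2` made explicit. -/
noncomputable def twistSum (q : F) (c m r : ℕ) : F :=
  ∑ l ∈ range (m + c + 1), (1 - q ^ 2) ^ l * ((-1) ^ l *
    (ufact q (m + c) * (ufact q (m + c - l))⁻¹ * (ufact q l)⁻¹ *
      (ufact q (l + r + (m + c) + 1) * (ufact q (r + (m + c) + 1))⁻¹) * gammaCoef (-q) (l + r)))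

lemma bCoef_eq (hq : IsPrimitiveRoot q p) (hp : p.Prime) (hp2 : p ≠ 2) {c m r : ℕ}
    (hr : 2 * (m + r + c) + 2 < p) :
    bCoef (-q) c (m + r) m =
      qfact (-q) (m + r) / (qfact (-q) m * qfact (-q) r) * twistSum q c m r := by
  have hq0 := one_sub_sq_ne_zero hq hp hp2
  have hu : ∀ {n : ℕ}, n < p → ufact q n ≠ 0 := fun hn =>
    (ufact_mem_unitsIn (S := ⊤) hq (Subring.mem_top q) hp hp2 hn).1
  rw [bCoef, twistSum, mul_sum]
  refine sum_congr rfl fun l hl => ?_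
  obtain ⟨s, hs⟩ := Nat.exists_eq_add_of_le (Nat.lt_succ_iff.mp (mem_range.mp hl))
  have e1 : l + (m + r) - m = l + r := by omega
  have e2 : l + r - l = r := by omega
  have e3 : m + c - l = s := by omega
  have e4 : l + r + (m + c) + 1 - l = r + (m + c) + 1 := by omega
  rw [Ccoef, e1, e2, e3, e4]
  simp only [qfact_eq hq hp hp2]
  have h1 := hu (show l + r < p by omega)
  have h2 := hu (show m < p by omega)
  have h3 := hu (show r < p by omega)
  have h4 := hu (show s < p by omega)
  have h5 := hu (show l < p by omega)
  have h6 := hu (show r + (m + c) + 1 < p by omega)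
  rw [hs] at h6 ⊢
  field_simp
  ring

lemma aCoef_mul (hq : IsPrimitiveRoot q p) (hp : p.Prime) (hp2 : p ≠ 2) {c m r : ℕ}
    (hr : 2 * (m + r + c) + 2 < p) (hc : 2 * c + m + 1 < p) :
    aCoef (-q) c m (m + r) = uodd q (c + (m + r)) * qpfact (-q) (2 * c + (m + r) + 1) *
      twistSum q c m r *
        ((ufact q r)⁻¹ * (uodd q (c + m))⁻¹ * (qpfact (-q) (2 * c + m + 1))⁻¹) := by
  have hq0 := one_sub_sq_ne_zero hq hp hp2
  have hT := Subring.mem_top q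
  have hu : ∀ {n : ℕ}, n < p → ufact q n ≠ 0 := fun hn =>
    (ufact_mem_unitsIn (S := ⊤) hq hT hp hp2 hn).1
  have h1 := hu (show m + r < p by omega)
  have h2 := hu (show m < p by omega)
  have h3 := hu (show r < p by omega)
  have h4 := (qpfact_mem_unitsIn (S := ⊤) hq hT hp hp2 hc).1
  have h5 := (uodd_mem_unitsIn (S := ⊤) hq hT hp hp2 (show 2 * (c + m) + 1 < p by omega)).1
  rw [aCoef, Rcoef, bCoef_eq hq hp hp2 hr, ← mul_add 2 c (m + r), ← mul_add 2 c m]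
  simp only [qfact_eq hq hp hp2, qdfact_eq hq hp hp2]
  field_simp
  ring

lemma twistSum_cong (hq : IsPrimitiveRoot q p) (hqS : q ∈ S) (hp : p.Prime) (hp2 : p ≠ 2)
    {c m r : ℕ} (hr : 2 * (m + r + c) + 2 < p) :
    CongMod S (1 - q ^ 2) (twistSum q c m r) (gammaCoef (-q) r) := by
  have hu : ∀ {n : ℕ}, n < p → ufact q n ∈ unitsIn S :=
    fun hn => ufact_mem_unitsIn hq hqS hp hp2 hn
  have hh : 1 - q ^ 2 ∈ S := S.sub_mem S.one_mem (S.pow_mem hqS 2)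
  rw [twistSum, sum_range_succ', add_comm]
  have h0 : ∀ l ∈ range (m + c), CongMod S (1 - q ^ 2) ((1 - q ^ 2) ^ (l + 1) * ((-1) ^ (l + 1) *
      (ufact q (m + c) * (ufact q (m + c - (l + 1)))⁻¹ * (ufact q (l + 1))⁻¹ *
        (ufact q (l + 1 + r + (m + c) + 1) * (ufact q (r + (m + c) + 1))⁻¹) *
        gammaCoef (-q) (l + 1 + r)))) 0 := by
    intro l hl
    have hl := mem_range.mp hl
    have hS := S.mul_mem (S.pow_mem (S.neg_mem S.one_mem) (l + 1))
      (S.mul_mem (S.mul_mem (S.mul_mem (S.mul_mem (hu (show m + c < p by omega)).2.1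
        (hu (show m + c - (l + 1) < p by omega)).2.2) (hu (show l + 1 < p by omega)).2.2)
        (S.mul_mem (hu (show l + 1 + r + (m + c) + 1 < p by omega)).2.1
          (hu (show r + (m + c) + 1 < p by omega)).2.2))
        (gammaCoef_mem hq hqS hp hp2 (show 2 * (l + 1 + r) + 1 < p by omega)))
    exact ⟨S.mul_mem (S.pow_mem hh _) hS, S.zero_mem, _, S.mul_mem (S.pow_mem hh l) hS, by ring⟩
  have h1 := (hu (show m + c < p by omega)).1
  have h2 := (hu (show r + (m + c) + 1 < p by omega)).1
  have h3 := (CongMod.refl (h := 1 - q ^ 2)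
    (gammaCoef_mem hq hqS hp hp2 (show 2 * r + 1 < p by omega))).add (CongMod.sum _ h0)
  have h4 : ufact q 0 = 1 := prod_range_zero _
  simpa [h1, h2, h4] using h3

lemma aCoef_mem (hq : IsPrimitiveRoot q p) (hqS : q ∈ S) (hp : p.Prime) (hp2 : p ≠ 2)
    {c m r : ℕ} (hr : 2 * (m + r + c) + 2 < p) (hc : 2 * c + (m + r) + 1 < p) :
    aCoef (-q) c m (m + r) ∈ S := by
  rw [aCoef_mul hq hp hp2 hr (by omega)]
  refine S.mul_mem (S.mul_mem (S.mul_mem ?_ ?_) ?_) (S.mul_mem (S.mul_mem ?_ ?_) ?_)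
  · exact (uodd_mem_unitsIn hq hqS hp hp2 (by omega)).2.1
  · exact (qpfact_mem_unitsIn hq hqS hp hp2 hc).2.1
  · exact (twistSum_cong hq hqS hp hp2 hr).left_mem
  · exact (ufact_mem_unitsIn hq hqS hp hp2 (by omega)).2.2
  · exact (uodd_mem_unitsIn hq hqS hp hp2 (by omega)).2.2
  · exact (qpfact_mem_unitsIn hq hqS hp hp2 (by omega)).2.2

lemma aCoef_cong (hq : IsPrimitiveRoot q p) (hqS : q ∈ S) (hp : p.Prime) (hp2 : p ≠ 2)
    {c m r : ℕ} (hr : 2 * (m + r + c) + 2 < p) (hc : 2 * c + (m + r) + 1 < p) :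
    CongMod S (1 - q ^ 2)
      ((r.factorial : F) * (oddDFact (c + m) : F) * aCoef (-q) c m (m + r))
      ((-1) ^ r * (oddDFact (c + (m + r)) : F)) := by
  have ha := aCoef_mem hq hqS hp hp2 hr hc
  have hW := gammaCoef_denom_cong hq hqS hp hp2 r
  have hY := ((twistSum_cong hq hqS hp hp2 hr).mul (CongMod.refl hW.left_mem)).trans
    (gammaCoef_mul_denom_cong hq hqS hp hp2 (by omega))
  have hL := (CongMod.refl (h := 1 - q ^ 2) ha).mul ((((ufact_cong hq hqS hp hp2 r).mul
    (uodd_cong hq hqS hp hp2 (c + m))).mul (qpfact_cong hq hqS hp hp2 (2 * c + m + 1))).mul hW)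
  have hR := ((uodd_cong hq hqS hp hp2 (c + (m + r))).mul
    (qpfact_cong hq hqS hp hp2 (2 * c + (m + r) + 1))).mul hY
  have e : aCoef (-q) c m (m + r) * (ufact q r * uodd q (c + m) * qpfact (-q) (2 * c + m + 1) *
      ∏ k ∈ Icc 1 r, ((-q) ^ (2 * k + 1) - 1)) =
      uodd q (c + (m + r)) * qpfact (-q) (2 * c + (m + r) + 1) *
        (twistSum q c m r * ∏ k ∈ Icc 1 r, ((-q) ^ (2 * k + 1) - 1)) := by
    have h1 := (ufact_mem_unitsIn hq hqS hp hp2 (show r < p by omega)).1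
    have h2 := (uodd_mem_unitsIn hq hqS hp hp2 (show 2 * (c + m) + 1 < p by omega)).1
    have h3 := (qpfact_mem_unitsIn hq hqS hp hp2 (show 2 * c + m + 1 < p by omega)).1
    rw [aCoef_mul hq hp hp2 hr (by omega)]
    field_simp
  rw [e] at hL
  refine CongMod.cancel_two_pow hq hqS hp hp2 ?_ ?_ (2 * c + (m + r) + 1) ?_
  · exact S.mul_mem (S.mul_mem (natCast_mem S _) (natCast_mem S _)) ha
  · exact S.mul_mem (S.pow_mem (S.neg_mem S.one_mem) _) (natCast_mem S _)
  have h := (CongMod.refl (S.pow_mem (S.neg_mem S.one_mem) (c + m + 1))).mul (hL.symm.trans hR)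
  have hs : ∀ k : ℕ, ((-1 : F) ^ k) ^ 2 = 1 := fun k => by rw [← pow_mul, pow_mul', neg_one_sq,
    one_pow]
  convert h using 1
  · rw [neg_pow (2 : F) r]
    linear_combination (-(2 : F) ^ (2 * c + (m + r) + 1) * r.factorial * oddDFact (c + m) *
      aCoef (-q) c m (m + r)) * ((hs r) * ((-1 : F) ^ (c + m + 1)) ^ 2 + hs (c + m + 1))
  · rw [show c + (m + r) + 1 = (c + m + 1) + r by ring, pow_add (-1 : F) (c + m + 1) r]
    linear_combination (-(2 : F) ^ (2 * c + (m + r) + 1) * oddDFact (c + (m + r)) *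
      (-1 : F) ^ r) * hs (c + m + 1)

end TwistCoefficient

/-- Lemma 5.5 for `t`: `a^{(c)}_{m,n}` lies in `O = ℤ[ζ]` and
`(n-m)!·(2c+2m+1)!!·a^{(c)}_{m,n} - (-1)^{n-m}·(2c+2n+1)!! ∈ (1-ζ)·O`,
where `(n-m)!`, `(2c+2m+1)!!`, `(2c+2n+1)!!` are ordinary integers. -/
theorem stmt16 (p : ℕ) (hp : p.Prime) (hp5 : 5 ≤ p) (ζ : ℂ)
    (hζ : IsPrimitiveRoot ζ p) (A : ℂ) (hA : A = -ζ ^ ((p - 1) / 2 + 1))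
    (c m n : ℕ) (hc : c ≤ (p - 1) / 2 - 1) (hmn : m ≤ n)
    (hn : n ≤ (p - 1) / 2 - c - 1) :
    aCoef A c m n ∈ Oring ζ ∧
    ∃ x : Oring ζ,
      (((n - m).factorial : ℕ) : ℂ) * ((oddDFact (c + m) : ℕ) : ℂ) * aCoef A c m n -
          (-1 : ℂ) ^ (n - m) * ((oddDFact (c + n) : ℕ) : ℂ) = (1 - ζ) * (x : ℂ) := by
  have hp2 : p ≠ 2 := by omega
  obtain ⟨k, hk⟩ := hp.odd_of_ne_two hp2
  have hd : (p - 1) / 2 = k := by omega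
  rw [hd] at hA hc hn
  obtain ⟨r, rfl⟩ := Nat.exists_eq_add_of_le hmn
  have hζS : ζ ∈ Oring ζ := Subring.subset_closure rfl
  have hq : IsPrimitiveRoot (ζ ^ (k + 1)) p :=
    hζ.pow_of_coprime _ (coprime_of_pos_of_lt hp k.succ_pos (by omega))
  have hqS : ζ ^ (k + 1) ∈ Oring ζ := (Oring ζ).pow_mem hζS _
  have hsq : (ζ ^ (k + 1)) ^ 2 = ζ := by
    rw [← pow_mul, show (k + 1) * 2 = p + 1 by omega, pow_succ, hζ.pow_eq_one, one_mul]
  have hr : 2 * (m + r + c) + 2 < p := by omega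
  have hc' : 2 * c + (m + r) + 1 < p := by omega
  subst hA
  refine ⟨aCoef_mem hq hqS hp hp2 hr hc', ?_⟩
  obtain ⟨z, hz, e⟩ := (aCoef_cong hq hqS hp hp2 hr hc').exists_eq
  rw [hsq] at e
  exact ⟨⟨z, hz⟩, by rw [Nat.add_sub_cancel_left]; exact e⟩
end
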